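/- Let (X,d) be a compact metric space, f: X → X a homeomorphism, and A: X → GL(m,ℝ) a continuous matrix function. If there exist two ergodic f-invariant measures with different maximal Lyapunov exponents with respect to A, then h_top(f) = sup{ max{h_μ(f), h_ν(f)} : μ, ν ergodic f-invariant measures with χ_max(A,μ) > χ_max(A,ν) }. -/

import Mathlib

open Filter MeasureTheory Set Topology Manifold
open scoped ENNReal NNReal

section EntropyDefs

variable {X : Type*} [MetricSpace X]

/-- The open dynamical (Bowen) ball `B_n(x,r) = {y | d_n(x,y) < r}`. -/
def dynBall (f : X → X) (x : X) (n : ℕ) (r : ℝ) : Set X :=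
  {y | ∀ i < n, dist (f^[i] x) (f^[i] y) < r}

/-- The closed dynamical (Bowen) ball `{y | d_n(x,y) ≤ r}`. -/
def dynCBall (f : X → X) (x : X) (n : ℕ) (r : ℝ) : Set X :=
  {y | ∀ i < n, dist (f^[i] x) (f^[i] y) ≤ r}

/-- `S` is an `(n,ε)`-separated subset of `E`. -/
def IsDynSep (f : X → X) (E : Set X) (n : ℕ) (ε : ℝ) (S : Set X) : Prop :=
  S ⊆ E ∧ ∀ x ∈ S, ∀ y ∈ S, x ≠ y → ∃ i < n, ε < dist (f^[i] x) (f^[i] y)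

/-- The maximal cardinality `s_n(E,ε)` of an `(n,ε)`-separated subset of `E`. -/
noncomputable def sepCount (f : X → X) (E : Set X) (n : ℕ) (ε : ℝ) : ℕ :=
  sSup {k | ∃ S : Finset X, IsDynSep f E n ε ↑S ∧ S.card = k}

/-- Bowen's separated-set topological entropy of a compact set:
`lim_{ε→0} limsup_n (1/n) log s_n(E,ε)`. -/
noncomputable def compactEnt (f : X → X) (E : Set X) : EReal :=
  ⨆ (ε : ℝ) (_ : 0 < ε),
    Filter.limsup (fun n : ℕ => ((Real.log (sepCount f E n ε) / n : ℝ) : EReal)) Filter.atTop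

/-- Topological entropy of an arbitrary subset `Y`: the supremum over compact `E ⊆ Y`. -/
noncomputable def topEnt (f : X → X) (Y : Set X) : EReal :=
  ⨆ (E : Set X) (_ : IsCompact E) (_ : E ⊆ Y), compactEnt f E

/-- The sum `Σ e^{-t·u}` over a family of Bowen balls recorded as center/order pairs. -/
noncomputable def bowenSum (t : ℝ) (s : Set (X × ℕ)) : ℝ≥0∞ :=
  ∑' p : s, ENNReal.ofReal (Real.exp (-t * ((p : X × ℕ).2 : ℝ)))

/-- `C(E;t,n,σ,f)`: infimum of `Σ e^{-t·u}` over countable covers of `E` by Bowen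
balls `B_u(x,σ)` with `u ≥ n`. -/
noncomputable def bowenCn (f : X → X) (E : Set X) (t : ℝ) (σ : ℝ) (n : ℕ) : ℝ≥0∞ :=
  ⨅ (s : Set (X × ℕ)) (_ : s.Countable) (_ : ∀ p ∈ s, n ≤ p.2)
    (_ : E ⊆ ⋃ p ∈ s, dynBall f p.1 p.2 σ), bowenSum t s

/-- `C(E;t,σ,f) = lim_{n→∞} C(E;t,n,σ,f)` (the limit of the nondecreasing sequence). -/
noncomputable def bowenC (f : X → X) (E : Set X) (t : ℝ) (σ : ℝ) : ℝ≥0∞ :=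
  ⨆ n : ℕ, bowenCn f E t σ n

/-- Bowen–Hausdorff entropy at scale `σ`: `inf {t | C(E;t,σ,f) = 0}`. -/
noncomputable def bowenEntAt (f : X → X) (E : Set X) (σ : ℝ) : EReal :=
  sInf {t : EReal | ∃ t' : ℝ, t = (t' : EReal) ∧ bowenC f E t' σ = 0}

/-- Bowen–Hausdorff entropy `h^B_top(f,E) = lim_{σ→0} h^B_top(E;σ,f)`. -/
noncomputable def bowenEnt (f : X → X) (E : Set X) : EReal :=
  ⨆ (σ : ℝ) (_ : 0 < σ), bowenEntAt f E σ

/-- Feng–Huang packing pre-measure `P^s_{N,ε}(E)`: supremum of `Σ e^{-s·n_i}` over countable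
pairwise disjoint families of closed Bowen balls of orders `n_i ≥ N` centered in `E`. -/
noncomputable def packPre (f : X → X) (s : ℝ) (N : ℕ) (ε : ℝ) (E : Set X) : ℝ≥0∞ :=
  ⨆ (D : Set (X × ℕ)) (_ : D.Countable) (_ : ∀ p ∈ D, p.1 ∈ E ∧ N ≤ p.2)
    (_ : D.Pairwise fun p q => Disjoint (dynCBall f p.1 p.2 ε) (dynCBall f q.1 q.2 ε)),
    ∑' p : D, ENNReal.ofReal (Real.exp (-s * ((p : X × ℕ).2 : ℝ)))

/-- `P^s_ε(E) = lim_{N→∞} P^s_{N,ε}(E)` (the limit of the nonincreasing sequence). -/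
noncomputable def packPreLim (f : X → X) (s ε : ℝ) (E : Set X) : ℝ≥0∞ :=
  ⨅ N : ℕ, packPre f s N ε E

/-- Feng–Huang packing measure `𝒫^s_ε(E) = inf {Σ_i P^s_ε(E_i) | E ⊆ ⋃ E_i}`. -/
noncomputable def packMeas (f : X → X) (s ε : ℝ) (E : Set X) : ℝ≥0∞ :=
  ⨅ (C : ℕ → Set X) (_ : E ⊆ ⋃ i, C i), ∑' i, packPreLim f s ε (C i)

/-- Packing topological entropy at scale `ε`: the critical exponent of `s ↦ 𝒫^s_ε(E)`. -/
noncomputable def packEntAt (f : X → X) (E : Set X) (ε : ℝ) : EReal :=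
  sInf {t : EReal | ∃ t' : ℝ, t = (t' : EReal) ∧ packMeas f t' ε E = 0}

/-- Packing topological entropy `h^P_top(f,E) = lim_{ε→0} h^P_top(f,E,ε)`. -/
noncomputable def packEnt (f : X → X) (E : Set X) : EReal :=
  ⨆ (ε : ℝ) (_ : 0 < ε), packEntAt f E ε

/-- The restriction of `f` to `Λ` is topologically mixing. -/
def TopMixingOn (f : X → X) (Λ : Set X) : Prop :=
  ∀ U V : Set X, IsOpen U → IsOpen V → (U ∩ Λ).Nonempty → (V ∩ Λ).Nonempty →
    ∃ N : ℕ, ∀ n ≥ N, (f^[n] '' (U ∩ Λ) ∩ (V ∩ Λ)).Nonempty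

end EntropyDefs

section MetricEntropy

variable {X : Type*} [MeasurableSpace X]

/-- Entropy `H_μ(⋁_{i=0}^{n-1} f^{-i} ξ)` of the `n`-th dynamical refinement of the finite
measurable partition `ξ = {P⁻¹(c)}_{c}`. -/
noncomputable def partHn (f : X → X) (μ : MeasureTheory.Measure X) {k : ℕ}
    (P : X → Fin k) (n : ℕ) : ℝ :=
  ∑ c : Fin n → Fin k,
    Real.negMulLog (μ {x | ∀ i : Fin n, P (f^[(i : ℕ)] x) = c i}).toReal

/-- Kolmogorov–Sinai metric entropy `h_μ(f)`: the supremum over finite measurable partitions of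
`lim_n (1/n) H_μ(⋁_{i<n} f^{-i} ξ) = inf_{n ≥ 1} (1/n) H_μ(⋁_{i<n} f^{-i} ξ)`. -/
noncomputable def ksEnt (f : X → X) (μ : MeasureTheory.Measure X) : EReal :=
  ⨆ (k : ℕ) (P : X → Fin k) (_ : Measurable P),
    (((⨅ n : ℕ, partHn f μ P (n + 1) / ((n : ℝ) + 1)) : ℝ) : EReal)

end MetricEntropy

section CocycleDefs

/-- Euclidean space `ℝ^m`. -/
abbrev Em (m : ℕ) := EuclideanSpace ℝ (Fin m)

variable {X : Type*} {m : ℕ}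

/-- The cocycle generated by the `GL(m,ℝ)`-valued function `A` over `f`:
`A(x,n) = A(f^{n-1}x) ⋯ A(f x) A(x)`. -/
noncomputable def cocycle (f : X → X) (A : X → (Em m ≃L[ℝ] Em m)) (x : X) :
    ℕ → (Em m →L[ℝ] Em m)
  | 0 => ContinuousLinearMap.id ℝ (Em m)
  | n + 1 => ((A (f^[n] x) : Em m →L[ℝ] Em m)).comp (cocycle f A x n)

/-- `A` is an `α`-Hölder continuous matrix function for some exponent `α > 0`
(in the operator norm). -/
def HolderMat [MetricSpace X] (A : X → (Em m ≃L[ℝ] Em m)) : Prop :=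
  ∃ α C : ℝ, 0 < α ∧ 0 ≤ C ∧ ∀ x y : X,
    ‖((A x : Em m →L[ℝ] Em m)) - ((A y : Em m →L[ℝ] Em m))‖ ≤ C * dist x y ^ α

/-- The set `MLI(A,f)` of Max-Lyapunov-irregular points: points where
`lim_n (1/n) log ‖A(x,n)‖` does not exist. -/
def MLIrr (f : X → X) (A : X → (Em m ≃L[ℝ] Em m)) : Set X :=
  {x | ¬ ∃ c : ℝ,
    Filter.Tendsto (fun n : ℕ => Real.log ‖cocycle f A x n‖ / n) Filter.atTop (nhds c)}

/-- The maximal Lyapunov exponent of an invariant measure: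
`χ_max(A,μ) = lim_n (1/n) ∫ log ‖A(x,n)‖ dμ = inf_{n ≥ 1} (1/n) ∫ log ‖A(x,n)‖ dμ`. -/
noncomputable def mle [MeasurableSpace X] (f : X → X) (A : X → (Em m ≃L[ℝ] Em m))
    (μ : MeasureTheory.Measure X) : ℝ :=
  ⨅ n : ℕ, (∫ x, Real.log ‖cocycle f A x (n + 1)‖ ∂μ) / ((n : ℝ) + 1)

/-- `μ` is a Lyapunov-minimizing (ergodic) measure for the cocycle `A`:
`χ_max(A,μ) = inf {χ_max(A,ν) : ν an f-invariant Borel probability measure}`. -/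
def IsLyapMin [MeasurableSpace X] (f : X → X) (A : X → (Em m ≃L[ℝ] Em m))
    (μ : MeasureTheory.Measure X) : Prop :=
  mle f A μ = sInf {r : ℝ | ∃ ν : MeasureTheory.Measure X,
    MeasureTheory.IsProbabilityMeasure ν ∧ MeasureTheory.MeasurePreserving f ν ν ∧
    r = mle f A ν}

end CocycleDefs

section DiscreteEntropy

open Real

/-- Gibbs' inequality for a single pair of weights. -/
lemma negMulLog_le_neg_mul_log_add_sub {p q : ℝ} (hp : 0 ≤ p) (hq : 0 ≤ q) (h : q = 0 → p = 0) :
    negMulLog p ≤ -p * log q + (q - p) := by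
  rcases hp.eq_or_lt with rfl | hp
  · simpa using hq
  have hq' : 0 < q := hq.lt_of_ne fun h0 => hp.ne' (h h0.symm)
  have h1 := log_le_sub_one_of_pos (div_pos hq' hp)
  rw [log_div hq'.ne' hp.ne'] at h1
  have h2 := mul_le_mul_of_nonneg_left h1 hp.le
  have h3 : p * (q / p - 1) = q - p := by field_simp
  rw [negMulLog]
  linarith

/-- `negMulLog` is subadditive on the nonnegative reals. -/
lemma negMulLog_add_le {a b : ℝ} (ha : 0 ≤ a) (hb : 0 ≤ b) :
    negMulLog (a + b) ≤ negMulLog a + negMulLog b := by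
  rcases ha.eq_or_lt with rfl | ha
  · simp
  rcases hb.eq_or_lt with rfl | hb
  · simp
  have h1 : log a ≤ log (a + b) := log_le_log ha (by linarith)
  have h2 : log b ≤ log (a + b) := log_le_log hb (by linarith)
  simp only [negMulLog]
  nlinarith

lemma negMulLog_sum_le {ι : Type*} (s : Finset ι) (p : ι → ℝ) (hp : ∀ i ∈ s, 0 ≤ p i) :
    negMulLog (∑ i ∈ s, p i) ≤ ∑ i ∈ s, negMulLog (p i) := by
  induction s using Finset.cons_induction with
  | empty => simp
  | cons a s ha ih =>
    rw [Finset.sum_cons, Finset.sum_cons]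
    have h := negMulLog_add_le (hp a (by simp))
      (Finset.sum_nonneg fun i hi => hp i (Finset.mem_cons_of_mem hi))
    linarith [ih fun i hi => hp i (Finset.mem_cons_of_mem hi)]

/-- The entropy of a weight vector with at most `N` nonzero entries. -/
lemma sum_negMulLog_le_of_card_le {ι : Type*} (s : Finset ι) (p : ι → ℝ) (hp : ∀ i ∈ s, 0 ≤ p i)
    {N : ℕ} (hN : s.card ≤ N) :
    ∑ i ∈ s, negMulLog (p i) ≤ negMulLog (∑ i ∈ s, p i) + (∑ i ∈ s, p i) * log N := by
  set P := ∑ i ∈ s, p i with hP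
  rcases (Finset.sum_nonneg hp).eq_or_lt with h0 | h0
  · have h1 : ∀ i ∈ s, p i = 0 := (Finset.sum_eq_zero_iff_of_nonneg hp).1 h0.symm
    have : ∑ i ∈ s, negMulLog (p i) = 0 :=
      Finset.sum_eq_zero fun i hi => by rw [h1 i hi, negMulLog_zero]
    rw [this, hP, ← h0]
    simp
  have hs : s.Nonempty := by
    by_contra hs
    rw [Finset.not_nonempty_iff_eq_empty] at hs
    simp [hs] at h0
  have hcard : (0 : ℝ) < s.card := by exact_mod_cast hs.card_pos
  have hNpos : (0 : ℝ) < N := lt_of_lt_of_le hcard (by exact_mod_cast hN)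
  have hq : 0 < P / N := div_pos h0 hNpos
  have h1 : ∀ i ∈ s, negMulLog (p i) ≤ -p i * log (P / N) + (P / N - p i) := fun i hi =>
    negMulLog_le_neg_mul_log_add_sub (hp i hi) hq.le fun h => absurd h hq.ne'
  refine (Finset.sum_le_sum h1).trans ?_
  rw [Finset.sum_add_distrib, ← Finset.sum_mul, Finset.sum_neg_distrib, Finset.sum_sub_distrib,
    ← hP, Finset.sum_const, nsmul_eq_mul, log_div h0.ne' hNpos.ne']
  have h2 : (s.card : ℝ) * (P / N) ≤ P := by
    rw [mul_div_left_comm]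
    exact mul_le_of_le_one_right h0.le ((div_le_one hNpos).2 (by exact_mod_cast hN))
  rw [negMulLog]
  nlinarith

/-- Subadditivity of conditional entropy: `H(c, c' | a, a') ≤ H(c | a) + H(c' | a')`, for the joint
weight `r` of `((a, c), (a', c'))`. -/
lemma condEntropy_subadd {A C A' C' : Type*} [Fintype A] [Fintype C] [Fintype A'] [Fintype C']
    (r : A × C → A' × C' → ℝ) (hr : ∀ p q, 0 ≤ r p q)
    (r₁ : A × C → ℝ) (h₁ : ∀ p, r₁ p = ∑ q, r p q)
    (r₂ : A' × C' → ℝ) (h₂ : ∀ q, r₂ q = ∑ p, r p q)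
    (m₁ : A → ℝ) (hm₁ : ∀ a, m₁ a = ∑ c, r₁ (a, c))
    (m₂ : A' → ℝ) (hm₂ : ∀ a, m₂ a = ∑ c, r₂ (a, c))
    (m : A → A' → ℝ) (hm : ∀ a a', m a a' = ∑ c, ∑ c', r (a, c) (a', c')) :
    ∑ p, ∑ q, negMulLog (r p q) - ∑ a, ∑ a', negMulLog (m a a') ≤
      (∑ p, negMulLog (r₁ p) - ∑ a, negMulLog (m₁ a)) +
        (∑ q, negMulLog (r₂ q) - ∑ a, negMulLog (m₂ a)) := by
  have hr₁ : ∀ p, 0 ≤ r₁ p := fun p => h₁ p ▸ Finset.sum_nonneg fun q _ => hr p q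
  have hr₂ : ∀ q, 0 ≤ r₂ q := fun q => h₂ q ▸ Finset.sum_nonneg fun p _ => hr p q
  have hm₁0 : ∀ a, 0 ≤ m₁ a := fun a => hm₁ a ▸ Finset.sum_nonneg fun q _ => hr₁ _
  have hm₂0 : ∀ a, 0 ≤ m₂ a := fun a => hm₂ a ▸ Finset.sum_nonneg fun q _ => hr₂ _
  have hm0 : ∀ a a', 0 ≤ m a a' := fun a a' => hm a a' ▸
    Finset.sum_nonneg fun c _ => Finset.sum_nonneg fun c' _ => hr _ _
  have key : ∀ p q, negMulLog (r p q) ≤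
      (r p q * (-log (r₁ p)) + r p q * log (m₁ p.1)) + (r p q * (-log (r₂ q)) +
        r p q * log (m₂ q.1)) + r p q * (-log (m p.1 q.1)) +
        (r₁ p * r₂ q * (m p.1 q.1 / (m₁ p.1 * m₂ q.1)) - r p q) := by
    intro p q
    rcases (hr p q).eq_or_lt with h0 | h0
    · rw [← h0]
      have := hr₁ p; have := hr₂ q; have := hm0 p.1 q.1; have := hm₁0 p.1; have := hm₂0 q.1
      simp only [negMulLog_zero, zero_mul, add_zero, sub_zero, zero_add]
      positivity
    · have i1 : 0 < r₁ p := h0.trans_le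
        (h₁ p ▸ Finset.single_le_sum (f := fun q => r p q) (fun q _ => hr p q) (Finset.mem_univ q))
      have i2 : 0 < r₂ q := h0.trans_le
        (h₂ q ▸ Finset.single_le_sum (f := fun p => r p q) (fun p _ => hr p q) (Finset.mem_univ p))
      have i3 : 0 < m₁ p.1 := i1.trans_le (hm₁ p.1 ▸ Finset.single_le_sum
        (f := fun c => r₁ (p.1, c)) (fun c _ => hr₁ _) (Finset.mem_univ p.2))
      have i4 : 0 < m₂ q.1 := i2.trans_le (hm₂ q.1 ▸ Finset.single_le_sum
        (f := fun c => r₂ (q.1, c)) (fun c _ => hr₂ _) (Finset.mem_univ q.2))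
      have i5 : 0 < m p.1 q.1 := by
        rw [hm]
        refine h0.trans_le ((Finset.single_le_sum (f := fun c' => r p (q.1, c'))
          (fun c' _ => hr _ _) (Finset.mem_univ q.2)).trans ?_)
        exact Finset.single_le_sum (f := fun c => ∑ c', r (p.1, c) (q.1, c'))
          (fun c _ => Finset.sum_nonneg fun c' _ => hr _ _) (Finset.mem_univ p.2)
      have i6 : 0 < r₁ p * r₂ q * (m p.1 q.1 / (m₁ p.1 * m₂ q.1)) := by positivity
      refine (negMulLog_le_neg_mul_log_add_sub h0.le i6.le fun h => absurd h i6.ne').trans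
        (le_of_eq ?_)
      rw [log_mul (by positivity) (by positivity), log_mul i1.ne' i2.ne',
        log_div i5.ne' (by positivity), log_mul i3.ne' i4.ne']
      ring
  have sum_s : ∑ p, ∑ q, r₁ p * r₂ q * (m p.1 q.1 / (m₁ p.1 * m₂ q.1)) ≤ ∑ a, ∑ a', m a a' := by
    simp only [Fintype.sum_prod_type]
    refine Finset.sum_le_sum fun a _ => ?_
    rw [Finset.sum_comm]
    refine Finset.sum_le_sum fun a' _ => ?_
    simp only [← Finset.sum_mul, ← Finset.mul_sum, ← hm₁, ← hm₂]
    rw [mul_div_assoc']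
    exact div_le_of_le_mul₀ (mul_nonneg (hm₁0 a) (hm₂0 a')) (hm0 a a') (le_of_eq (by ring))
  have sum_r : ∑ p, ∑ q, r p q = ∑ a, ∑ a', m a a' := by
    simp only [Fintype.sum_prod_type, hm]
    refine Finset.sum_congr rfl fun a _ => ?_
    rw [Finset.sum_comm]
  have e₁ : ∑ p, ∑ q, r p q * (-log (r₁ p)) = ∑ p, negMulLog (r₁ p) := by
    simp only [← Finset.sum_mul, ← h₁]
    simp only [negMulLog, neg_mul, mul_neg]
  have e₂ : ∑ p, ∑ q, r p q * (-log (r₂ q)) = ∑ q, negMulLog (r₂ q) := by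
    rw [Finset.sum_comm]
    simp only [← Finset.sum_mul, ← h₂]
    simp only [negMulLog, neg_mul, mul_neg]
  have e₃ : ∑ p, ∑ q, r p q * log (m₁ p.1) = -∑ a, negMulLog (m₁ a) := by
    simp only [← Finset.sum_mul, ← h₁]
    rw [Fintype.sum_prod_type]
    simp only [← Finset.sum_mul, ← hm₁, negMulLog, neg_mul, Finset.sum_neg_distrib, neg_neg]
  have e₄ : ∑ p, ∑ q, r p q * log (m₂ q.1) = -∑ a, negMulLog (m₂ a) := by
    rw [Finset.sum_comm]
    simp only [← Finset.sum_mul, ← h₂]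
    rw [Fintype.sum_prod_type]
    simp only [← Finset.sum_mul, ← hm₂, negMulLog, neg_mul, Finset.sum_neg_distrib, neg_neg]
  have e₅ : ∑ p, ∑ q, r p q * (-log (m p.1 q.1)) = ∑ a, ∑ a', negMulLog (m a a') := by
    simp only [Fintype.sum_prod_type]
    refine Finset.sum_congr rfl fun a _ => ?_
    rw [Finset.sum_comm]
    refine Finset.sum_congr rfl fun a' _ => ?_
    simp only [← Finset.sum_mul, ← hm]
    simp only [negMulLog, neg_mul, mul_neg]
  have total := Finset.sum_le_sum fun p (_ : p ∈ Finset.univ) =>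
    Finset.sum_le_sum fun q (_ : q ∈ Finset.univ) => key p q
  simp only [Finset.sum_add_distrib, Finset.sum_sub_distrib] at total
  rw [e₁, e₂, e₃, e₄, e₅, sum_r] at total
  linarith

/-- Subadditivity of entropy: `H(c, c') ≤ H(c) + H(c')` for a joint weight `r` of total mass `1`. -/
lemma entropy_subadd {C C' : Type*} [Fintype C] [Fintype C'] (r : C → C' → ℝ)
    (hr : ∀ p q, 0 ≤ r p q) (htot : ∑ p, ∑ q, r p q = 1) :
    ∑ p, ∑ q, negMulLog (r p q) ≤
      ∑ p, negMulLog (∑ q, r p q) + ∑ q, negMulLog (∑ p, r p q) := by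
  have htot' : ∑ q, ∑ p, r p q = 1 := by rw [Finset.sum_comm, htot]
  have h := condEntropy_subadd (A := Unit) (A' := Unit) (fun p q => r p.2 q.2)
    (fun p q => hr _ _) (fun p => ∑ q, r p.2 q) (fun p => by simp [Fintype.sum_prod_type])
    (fun q => ∑ p, r p q.2) (fun p => by simp [Fintype.sum_prod_type])
    (fun _ => 1) (fun _ => by simp [htot]) (fun _ => 1) (fun _ => by simp [htot'])
    (fun _ _ => 1) (fun _ _ => by simp [htot])
  simpa [Fintype.sum_prod_type] using h

end DiscreteEntropy

section RandomCoding

open Real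

/-- The probability that independent random codings of `x, f x, …, f^[n-1] x` produce the word
`c`. -/
def codeWeight {X ι : Type*} (f : X → X) (ψ : ι → X → ℝ) (n : ℕ) (c : Fin n → ι)
    (x : X) : ℝ :=
  ∏ i, ψ (c i) (f^[(i : ℕ)] x)

lemma codeWeight_append {X ι : Type*} {f : X → X} {ψ : ι → X → ℝ} (p q : ℕ) (c : Fin p → ι)
    (d : Fin q → ι) (x : X) :
    codeWeight f ψ (p + q) (Fin.append c d) x =
      codeWeight f ψ p c x * codeWeight f ψ q d (f^[p] x) := by
  simp only [codeWeight, Fin.prod_univ_add, Fin.append_left, Fin.append_right, Fin.val_castAdd,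
    Fin.val_natAdd, ← Function.iterate_add_apply, add_comm p]

lemma codeWeight_snoc {X ι : Type*} {f : X → X} {ψ : ι → X → ℝ} (n : ℕ) (c : Fin n → ι)
    (a : ι) (x : X) :
    codeWeight f ψ (n + 1) (Fin.snoc (α := fun _ => ι) c a) x =
      codeWeight f ψ n c x * ψ a (f^[n] x) := by
  simp only [codeWeight, Fin.prod_univ_castSucc, Fin.snoc_castSucc, Fin.snoc_last,
    Fin.val_castSucc, Fin.val_last]

variable {X : Type*} [MeasurableSpace X] {ι κ : Type*} [Fintype ι] [Fintype κ]

/-- A measurable family of probability vectors indexed by the points of `X`, viewed as a random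
coding of the points of `X` by the symbols of `ι`. -/
structure IsObservable (ψ : ι → X → ℝ) : Prop where
  measurable : ∀ a, Measurable (ψ a)
  nonneg : ∀ a x, 0 ≤ ψ a x
  sum_eq_one : ∀ x, ∑ a, ψ a x = 1

/-- The entropy of the random word of length `n`. -/
noncomputable def codeEntropy (f : X → X) (ψ : ι → X → ℝ) (μ : Measure X) (n : ℕ) : ℝ :=
  ∑ c : Fin n → ι, negMulLog (∫ x, codeWeight f ψ n c x ∂μ)

/-- The entropy of the random symbol that codes the given point `x`. -/
noncomputable def noise (ψ : ι → X → ℝ) (x : X) : ℝ := ∑ a, negMulLog (ψ a x)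

/-- The mutual information between a `μ`-random point and its random word of length `n`. -/
noncomputable def codeInfo (f : X → X) (ψ : ι → X → ℝ) (μ : Measure X) (n : ℕ) : ℝ :=
  codeEntropy f ψ μ n - ∑ i ∈ Finset.range n, ∫ x, noise ψ (f^[i] x) ∂μ

/-- The joint entropy of the words of length `n` produced by two codings. -/
noncomputable def jointEntropy (f : X → X) (φ : κ → X → ℝ) (ψ : ι → X → ℝ) (μ : Measure X)
    (n : ℕ) : ℝ :=
  ∑ p : (Fin n → κ) × (Fin n → ι),
    negMulLog (∫ x, codeWeight f φ n p.1 x * codeWeight f ψ n p.2 x ∂μ)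

lemma integrable_of_unit_bounds {μ : Measure X} [IsProbabilityMeasure μ] {g : X → ℝ}
    (hg : Measurable g) (h0 : ∀ x, 0 ≤ g x) (h1 : ∀ x, g x ≤ 1) : Integrable g μ :=
  Integrable.of_mem_Icc 0 1 hg.aemeasurable (Eventually.of_forall fun x => ⟨h0 x, h1 x⟩)

variable {f : X → X} {ψ : ι → X → ℝ} {φ : κ → X → ℝ} {μ : Measure X}

namespace IsObservable

lemma le_one (hψ : IsObservable ψ) (a : ι) (x : X) : ψ a x ≤ 1 :=
  hψ.sum_eq_one x ▸ Finset.single_le_sum (f := fun a => ψ a x) (fun a _ => hψ.nonneg a x)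
    (Finset.mem_univ a)

lemma codeWeight_nonneg (hψ : IsObservable ψ) (n : ℕ) (c : Fin n → ι) (x : X) :
    0 ≤ codeWeight f ψ n c x :=
  Finset.prod_nonneg fun _ _ => hψ.nonneg _ _

lemma codeWeight_le_one (hψ : IsObservable ψ) (n : ℕ) (c : Fin n → ι) (x : X) :
    codeWeight f ψ n c x ≤ 1 :=
  Finset.prod_le_one (fun _ _ => hψ.nonneg _ _) fun _ _ => hψ.le_one _ _

lemma measurable_codeWeight (hψ : IsObservable ψ) (hf : Measurable f) (n : ℕ) (c : Fin n → ι) :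
    Measurable (codeWeight f ψ n c) :=
  Finset.measurable_prod _ fun i _ => (hψ.measurable (c i)).comp (hf.iterate _)

lemma sum_codeWeight (hψ : IsObservable ψ) (n : ℕ) (x : X) :
    ∑ c : Fin n → ι, codeWeight f ψ n c x = 1 := by
  classical
  have h := Finset.prod_univ_sum (fun _ : Fin n => (Finset.univ : Finset ι))
    (fun i a => ψ a (f^[(i : ℕ)] x))
  simp only [hψ.sum_eq_one, Finset.prod_const_one, Fintype.piFinset_univ] at h
  exact h.symm

lemma integrable_codeWeight [IsProbabilityMeasure μ] (hψ : IsObservable ψ) (hf : Measurable f)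
    (n : ℕ) (c : Fin n → ι) : Integrable (codeWeight f ψ n c) μ :=
  integrable_of_unit_bounds (hψ.measurable_codeWeight hf n c) (hψ.codeWeight_nonneg n c)
    (hψ.codeWeight_le_one n c)

lemma integral_codeWeight_nonneg (hψ : IsObservable ψ) (n : ℕ) (c : Fin n → ι) :
    0 ≤ ∫ x, codeWeight f ψ n c x ∂μ :=
  integral_nonneg fun x => hψ.codeWeight_nonneg n c x

lemma integral_codeWeight_le_one [IsProbabilityMeasure μ] (hψ : IsObservable ψ)
    (hf : Measurable f) (n : ℕ) (c : Fin n → ι) : ∫ x, codeWeight f ψ n c x ∂μ ≤ 1 := by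
  simpa using integral_mono (hψ.integrable_codeWeight hf n c) (integrable_const (μ := μ) (1 : ℝ))
    fun x => hψ.codeWeight_le_one n c x

lemma noise_nonneg (hψ : IsObservable ψ) (x : X) : 0 ≤ noise ψ x :=
  Finset.sum_nonneg fun a _ => negMulLog_nonneg (hψ.nonneg a x) (hψ.le_one a x)

lemma noise_le (hψ : IsObservable ψ) (x : X) : noise ψ x ≤ Fintype.card ι := by
  refine (Finset.sum_le_card_nsmul _ _ 1 fun a _ => ?_).trans (by simp)
  linarith [negMulLog_le_one_sub_self (hψ.nonneg a x), hψ.nonneg a x]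

lemma measurable_noise (hψ : IsObservable ψ) : Measurable (noise ψ) :=
  Finset.measurable_sum _ fun a _ => continuous_negMulLog.measurable.comp (hψ.measurable a)

lemma integrable_noise_comp [IsProbabilityMeasure μ] (hψ : IsObservable ψ) {g : X → X}
    (hg : Measurable g) : Integrable (fun x => noise ψ (g x)) μ :=
  Integrable.of_mem_Icc 0 (Fintype.card ι) (hψ.measurable_noise.comp hg).aemeasurable
    (Eventually.of_forall fun _ => ⟨hψ.noise_nonneg _, hψ.noise_le _⟩)

lemma codeEntropy_nonneg [IsProbabilityMeasure μ] (hψ : IsObservable ψ) (hf : Measurable f)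
    (n : ℕ) : 0 ≤ codeEntropy f ψ μ n :=
  Finset.sum_nonneg fun c _ =>
    negMulLog_nonneg (hψ.integral_codeWeight_nonneg n c) (hψ.integral_codeWeight_le_one hf n c)

lemma neg_mul_card_le_codeInfo [IsProbabilityMeasure μ] (hψ : IsObservable ψ)
    (hf : Measurable f) (n : ℕ) : -(n * Fintype.card ι : ℝ) ≤ codeInfo f ψ μ n := by
  have h : ∑ i ∈ Finset.range n, ∫ x, noise ψ (f^[i] x) ∂μ ≤ n * Fintype.card ι := by
    refine (Finset.sum_le_card_nsmul _ _ (Fintype.card ι : ℝ) fun i _ => ?_).trans (by simp)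
    simpa using integral_mono (hψ.integrable_noise_comp (hf.iterate i))
      (integrable_const (μ := μ) (Fintype.card ι : ℝ)) fun x => hψ.noise_le (f^[i] x)
  rw [codeInfo]
  linarith [hψ.codeEntropy_nonneg (μ := μ) hf n]

end IsObservable

/-- Subadditivity of the entropy of random words. -/
lemma codeEntropy_add_le [IsProbabilityMeasure μ] (hψ : IsObservable ψ) (hf : Measurable f)
    (p q : ℕ) :
    codeEntropy f ψ μ (p + q) ≤ codeEntropy f ψ μ p + codeEntropy f ψ (μ.map f^[p]) q := by
  have hfp := hf.iterate p
  set r : (Fin p → ι) → (Fin q → ι) → ℝ := fun c d =>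
    ∫ x, codeWeight f ψ p c x * codeWeight f ψ q d (f^[p] x) ∂μ with hr
  have hinteg : ∀ c d, Integrable
      (fun x => codeWeight f ψ p c x * codeWeight f ψ q d (f^[p] x)) μ := fun c d =>
    integrable_of_unit_bounds
      ((hψ.measurable_codeWeight hf p c).mul ((hψ.measurable_codeWeight hf q d).comp hfp))
      (fun x => mul_nonneg (hψ.codeWeight_nonneg _ _ _) (hψ.codeWeight_nonneg _ _ _))
      (fun x => mul_le_one₀ (hψ.codeWeight_le_one _ _ _) (hψ.codeWeight_nonneg _ _ _)
        (hψ.codeWeight_le_one _ _ _))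
  have hr0 : ∀ c d, 0 ≤ r c d := fun c d => integral_nonneg fun x =>
    mul_nonneg (hψ.codeWeight_nonneg _ _ _) (hψ.codeWeight_nonneg _ _ _)
  have m₁ : ∀ c, ∑ d, r c d = ∫ x, codeWeight f ψ p c x ∂μ := fun c => by
    simp only [hr]
    rw [← integral_finsetSum _ fun d _ => hinteg c d]
    simp only [← Finset.mul_sum, hψ.sum_codeWeight, mul_one]
  have m₂ : ∀ d, ∑ c, r c d = ∫ x, codeWeight f ψ q d x ∂(μ.map f^[p]) := fun d => by
    simp only [hr]
    rw [← integral_finsetSum _ fun c _ => hinteg c d, integral_map hfp.aemeasurable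
      (hψ.measurable_codeWeight hf q d).aestronglyMeasurable]
    simp only [← Finset.sum_mul, hψ.sum_codeWeight, one_mul]
  have htot : ∑ c, ∑ d, r c d = 1 := by
    simp only [m₁]
    rw [← integral_finsetSum _ fun c _ => hψ.integrable_codeWeight hf p c]
    simp [hψ.sum_codeWeight]
  have h := entropy_subadd r hr0 htot
  simp only [m₁, m₂] at h
  refine le_trans (le_of_eq ?_) h
  rw [codeEntropy, ← (Fin.appendEquiv p q).sum_comp, Fintype.sum_prod_type]
  simp only [hr, Fin.appendEquiv, Equiv.coe_fn_mk, codeWeight_append]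

/-- Subadditivity of the information carried by random words. -/
lemma codeInfo_add_le [IsProbabilityMeasure μ] (hψ : IsObservable ψ) (hf : Measurable f)
    (p q : ℕ) :
    codeInfo f ψ μ (p + q) ≤ codeInfo f ψ μ p + codeInfo f ψ (μ.map f^[p]) q := by
  have h := codeEntropy_add_le (μ := μ) hψ hf p q
  have h2 : ∀ i, ∫ x, noise ψ (f^[i] x) ∂(μ.map f^[p]) = ∫ x, noise ψ (f^[p + i] x) ∂μ := by
    intro i
    refine (integral_map (f := fun x => noise ψ (f^[i] x)) (hf.iterate p).aemeasurable
      (hψ.measurable_noise.comp (hf.iterate i)).aestronglyMeasurable).trans ?_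
    simp only [← Function.iterate_add_apply, add_comm p]
  simp only [codeInfo, Finset.sum_range_add, h2]
  linarith

lemma codeEntropy_zero [IsProbabilityMeasure μ] : codeEntropy f ψ μ 0 = 0 := by
  simp [codeEntropy, codeWeight]

lemma jointEntropy_zero [IsProbabilityMeasure μ] : jointEntropy f φ ψ μ 0 = 0 := by
  simp [jointEntropy, codeWeight]

lemma codeEntropy_one : codeEntropy f ψ μ 1 = ∑ a, negMulLog (∫ x, ψ a x ∂μ) := by
  rw [codeEntropy, ← (Equiv.funUnique (Fin 1) ι).symm.sum_comp]
  simp [codeWeight]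

lemma map_iterate_eq (hμ : MeasurePreserving f μ μ) (n : ℕ) : μ.map f^[n] = μ :=
  (hμ.iterate n).map_eq

lemma codeEntropy_le_mul [IsProbabilityMeasure μ] (hψ : IsObservable ψ)
    (hμ : MeasurePreserving f μ μ) (n : ℕ) :
    codeEntropy f ψ μ n ≤ n * ∑ a, negMulLog (∫ x, ψ a x ∂μ) := by
  induction n with
  | zero => simp [codeEntropy_zero]
  | succ n ih =>
    have h := codeEntropy_add_le (μ := μ) hψ hμ.measurable n 1
    rw [map_iterate_eq hμ, codeEntropy_one] at h
    push_cast
    linarith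

section Joint

variable [IsProbabilityMeasure μ]

lemma integrable_codeWeight_mul (hφ : IsObservable φ) (hψ : IsObservable ψ)
    (hf : Measurable f) (n : ℕ) (d : Fin n → κ) (c : Fin n → ι) :
    Integrable (fun x => codeWeight f φ n d x * codeWeight f ψ n c x) μ :=
  integrable_of_unit_bounds
    ((hφ.measurable_codeWeight hf n d).mul (hψ.measurable_codeWeight hf n c))
    (fun _ => mul_nonneg (hφ.codeWeight_nonneg _ _ _) (hψ.codeWeight_nonneg _ _ _))
    (fun _ => mul_le_one₀ (hφ.codeWeight_le_one _ _ _) (hψ.codeWeight_nonneg _ _ _)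
      (hψ.codeWeight_le_one _ _ _))

lemma sum_integral_codeWeight_mul_left (hφ : IsObservable φ) (hψ : IsObservable ψ)
    (hf : Measurable f) (n : ℕ) (c : Fin n → ι) :
    ∑ d, ∫ x, codeWeight f φ n d x * codeWeight f ψ n c x ∂μ = ∫ x, codeWeight f ψ n c x ∂μ := by
  rw [← integral_finsetSum _ fun d _ => integrable_codeWeight_mul hφ hψ hf n d c]
  simp only [← Finset.sum_mul, hφ.sum_codeWeight, one_mul]

lemma sum_integral_codeWeight_mul_right (hφ : IsObservable φ) (hψ : IsObservable ψ)
    (hf : Measurable f) (n : ℕ) (d : Fin n → κ) :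
    ∑ c, ∫ x, codeWeight f φ n d x * codeWeight f ψ n c x ∂μ = ∫ x, codeWeight f φ n d x ∂μ := by
  rw [← integral_finsetSum _ fun c _ => integrable_codeWeight_mul hφ hψ hf n d c]
  simp only [← Finset.mul_sum, hψ.sum_codeWeight, mul_one]

lemma codeEntropy_le_jointEntropy (hφ : IsObservable φ) (hψ : IsObservable ψ)
    (hf : Measurable f) (n : ℕ) :
    codeEntropy f ψ μ n ≤ jointEntropy f φ ψ μ n := by
  rw [codeEntropy, jointEntropy, Fintype.sum_prod_type_right]
  refine Finset.sum_le_sum fun c _ => ?_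
  rw [← sum_integral_codeWeight_mul_left hφ hψ hf]
  exact negMulLog_sum_le _ _ fun d _ => integral_nonneg fun x =>
    mul_nonneg (hφ.codeWeight_nonneg _ _ _) (hψ.codeWeight_nonneg _ _ _)

/-- The conditional entropy of random words of length `n` grows at most linearly. -/
lemma jointEntropy_le (hφ : IsObservable φ) (hψ : IsObservable ψ)
    (hμ : MeasurePreserving f μ μ) (n : ℕ) :
    jointEntropy f φ ψ μ n ≤ codeEntropy f φ μ n +
      n * (∑ q : κ × ι, negMulLog (∫ x, φ q.1 x * ψ q.2 x ∂μ) -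
        ∑ j, negMulLog (∫ x, φ j x ∂μ)) := by
  have hf := hμ.measurable
  induction n with
  | zero => simp [codeEntropy_zero, jointEntropy_zero]
  | succ n ih =>
    have hfn := hf.iterate n
    set r : (Fin n → κ) × (Fin n → ι) → κ × ι → ℝ := fun p q =>
      ∫ x, (codeWeight f φ n p.1 x * codeWeight f ψ n p.2 x) *
        (φ q.1 (f^[n] x) * ψ q.2 (f^[n] x)) ∂μ with hr
    have hinteg : ∀ p : (Fin n → κ) × (Fin n → ι), ∀ q : κ × ι, Integrable (fun x =>
        (codeWeight f φ n p.1 x * codeWeight f ψ n p.2 x) *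
          (φ q.1 (f^[n] x) * ψ q.2 (f^[n] x))) μ := by
      intro p q
      have b1 : ∀ x, codeWeight f φ n p.1 x * codeWeight f ψ n p.2 x ≤ 1 := fun x =>
        mul_le_one₀ (hφ.codeWeight_le_one _ _ _) (hψ.codeWeight_nonneg _ _ _)
          (hψ.codeWeight_le_one _ _ _)
      have b2 : ∀ x, φ q.1 (f^[n] x) * ψ q.2 (f^[n] x) ≤ 1 := fun x =>
        mul_le_one₀ (hφ.le_one _ _) (hψ.nonneg _ _) (hψ.le_one _ _)
      have b3 : ∀ x, 0 ≤ φ q.1 (f^[n] x) * ψ q.2 (f^[n] x) := fun x =>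
        mul_nonneg (hφ.nonneg _ _) (hψ.nonneg _ _)
      have b4 : ∀ x, 0 ≤ codeWeight f φ n p.1 x * codeWeight f ψ n p.2 x := fun x =>
        mul_nonneg (hφ.codeWeight_nonneg _ _ _) (hψ.codeWeight_nonneg _ _ _)
      exact integrable_of_unit_bounds
        (((hφ.measurable_codeWeight hf n _).mul (hψ.measurable_codeWeight hf n _)).mul
          (((hφ.measurable _).comp hfn).mul ((hψ.measurable _).comp hfn)))
        (fun x => mul_nonneg (b4 x) (b3 x)) (fun x => mul_le_one₀ (b1 x) (b3 x) (b2 x))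
    have hr0 : ∀ p q, 0 ≤ r p q := fun p q => integral_nonneg fun x =>
      mul_nonneg (mul_nonneg (hφ.codeWeight_nonneg _ _ _) (hψ.codeWeight_nonneg _ _ _))
        (mul_nonneg (hφ.nonneg _ _) (hψ.nonneg _ _))
    have hint2 : ∀ q : κ × ι, Integrable (fun x => φ q.1 x * ψ q.2 x) μ := fun q =>
      integrable_of_unit_bounds ((hφ.measurable _).mul (hψ.measurable _))
        (fun _ => mul_nonneg (hφ.nonneg _ _) (hψ.nonneg _ _))
        (fun _ => mul_le_one₀ (hφ.le_one _ _) (hψ.nonneg _ _) (hψ.le_one _ _))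
    have h := condEntropy_subadd r hr0
      (fun p => ∫ x, codeWeight f φ n p.1 x * codeWeight f ψ n p.2 x ∂μ) (fun p => by
        simp only [hr]
        rw [← integral_finsetSum _ fun q _ => hinteg p q]
        simp only [← Finset.mul_sum, Fintype.sum_prod_type, hψ.sum_eq_one, hφ.sum_eq_one, mul_one])
      (fun q => ∫ x, φ q.1 x * ψ q.2 x ∂μ) (fun q => by
        simp only [hr]
        rw [← integral_finsetSum _ fun p _ => hinteg p q]
        simp only [← Finset.sum_mul, ← Finset.mul_sum, Fintype.sum_prod_type, hψ.sum_codeWeight,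
          hφ.sum_codeWeight, mul_one, one_mul]
        conv_lhs => rw [← map_iterate_eq hμ n]
        exact integral_map hfn.aemeasurable
          ((hφ.measurable _).mul (hψ.measurable _)).aestronglyMeasurable)
      (fun d => ∫ x, codeWeight f φ n d x ∂μ)
      (fun d => (sum_integral_codeWeight_mul_right hφ hψ hf n d).symm)
      (fun j => ∫ x, φ j x ∂μ) (fun j => by
        rw [← integral_finsetSum _ fun c _ => hint2 (j, c)]
        simp only [← Finset.mul_sum, hψ.sum_eq_one, mul_one])
      (fun d j => ∫ x, codeWeight f φ (n + 1) (Fin.snoc (α := fun _ => κ) d j) x ∂μ)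
      (fun d j => by
        simp only [hr]
        rw [Finset.sum_congr rfl fun c _ =>
          (integral_finsetSum Finset.univ fun a _ => hinteg (d, c) (j, a)).symm,
          ← integral_finsetSum _ fun c _ => integrable_finsetSum _ fun a _ => hinteg (d, c) (j, a)]
        simp only [← Finset.mul_sum, ← Finset.sum_mul, hψ.sum_eq_one, mul_one, hψ.sum_codeWeight,
          codeWeight_snoc])
    have e1 : jointEntropy f φ ψ μ (n + 1) = ∑ p, ∑ q, negMulLog (r p q) := by
      rw [jointEntropy,
        ← ((Fin.snocEquiv fun _ => κ).prodCongr (Fin.snocEquiv fun _ => ι)).sum_comp,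
        ← Fintype.sum_prod_type',
        ← (Equiv.prodProdProdComm κ (Fin n → κ) ι (Fin n → ι)).symm.sum_comp,
        ← (Equiv.prodComm _ _).sum_comp]
      refine Finset.sum_congr rfl fun x _ => ?_
      simp only [hr]
      congr 2
      ext y
      simp [codeWeight_snoc, Fin.snocEquiv]
      ring
    have e2 : codeEntropy f φ μ (n + 1) = ∑ d, ∑ j, negMulLog
        (∫ x, codeWeight f φ (n + 1) (Fin.snoc (α := fun _ => κ) d j) x ∂μ) := by
      rw [codeEntropy, ← (Fin.snocEquiv fun _ => κ).sum_comp, Fintype.sum_prod_type_right]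
      rfl
    rw [← e1, ← e2] at h
    rw [jointEntropy] at ih
    simp only [codeEntropy] at ih h ⊢
    push_cast
    linarith

end Joint

end RandomCoding

section PartitionCoding

open Real

variable {X : Type*} [MeasurableSpace X] {ι κ : Type*} [Fintype ι]

/-- The deterministic coding of the points of `X` by the cells of a partition. -/
noncomputable def partObs {X κ : Type*} (P : X → κ) (j : κ) (x : X) : ℝ :=
  (P ⁻¹' {j}).indicator 1 x

lemma isObservable_partObs [Fintype κ] {P : X → κ} (hP : ∀ j, MeasurableSet (P ⁻¹' {j})) :
    IsObservable (partObs P) where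
  measurable j := measurable_one.indicator (hP j)
  nonneg j x := indicator_nonneg (fun _ _ => zero_le_one) x
  sum_eq_one x := by
    classical
    simp [partObs, indicator_apply]

lemma integral_partObs_mul {μ : Measure X} {P : X → κ} (hP : ∀ j, MeasurableSet (P ⁻¹' {j}))
    (j : κ) (g : X → ℝ) : ∫ x, partObs P j x * g x ∂μ = ∫ x in P ⁻¹' {j}, g x ∂μ := by
  rw [← integral_indicator (hP j)]
  congr 1 with x
  by_cases hx : x ∈ P ⁻¹' {j} <;> simp [partObs, hx]

lemma integral_partObs {μ : Measure X} {P : X → κ} (hP : ∀ j, MeasurableSet (P ⁻¹' {j})) (j : κ) :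
    ∫ x, partObs P j x ∂μ = μ.real (P ⁻¹' {j}) :=
  integral_indicator_one (hP j)

lemma codeWeight_partObs {X κ : Type*} (f : X → X) (P : X → κ) (n : ℕ) (c : Fin n → κ) :
    codeWeight f (partObs P) n c = {x | ∀ i : Fin n, P (f^[(i : ℕ)] x) = c i}.indicator 1 := by
  classical
  ext x
  simp [codeWeight, partObs, indicator_apply, Finset.prod_boole]

lemma measurableSet_cylinder {f : X → X} (hf : Measurable f) {P : X → κ}
    (hP : ∀ j, MeasurableSet (P ⁻¹' {j})) (n : ℕ) (c : Fin n → κ) :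
    MeasurableSet {x | ∀ i : Fin n, P (f^[(i : ℕ)] x) = c i} := by
  have : {x | ∀ i : Fin n, P (f^[(i : ℕ)] x) = c i} =
      ⋂ i : Fin n, f^[(i : ℕ)] ⁻¹' (P ⁻¹' {c i}) := by
    ext x; simp
  rw [this]
  exact MeasurableSet.iInter fun i => (hf.iterate _) (hP _)

lemma partHn_eq_codeEntropy {f : X → X} (hf : Measurable f) (μ : Measure X) {k : ℕ}
    {P : X → Fin k} (hP : Measurable P) (n : ℕ) :
    partHn f μ P n = codeEntropy f (partObs P) μ n := by
  refine Finset.sum_congr rfl fun c _ => ?_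
  rw [codeWeight_partObs, integral_indicator_one
    (measurableSet_cylinder hf (fun j => hP (measurableSet_singleton j)) n c)]
  rfl

/-- The conditional entropy of the symbol of `x` given that `x` lies in a set `S` on which the
coding is almost constant. -/
lemma sum_negMulLog_setIntegral_le {μ : Measure X} [IsProbabilityMeasure μ] {ψ : ι → X → ℝ}
    (hψ : IsObservable ψ) {S : Set X} (hS : MeasurableSet S) {δ η : ℝ}
    (hosc : ∀ a, ∀ x ∈ S, ∀ y ∈ S, |ψ a x - ψ a y| ≤ δ)
    (hη : ∀ u ∈ Icc (0 : ℝ) 1, ∀ v ∈ Icc (0 : ℝ) 1, |u - v| ≤ δ → negMulLog u ≤ negMulLog v + η) :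
    ∑ a, negMulLog (∫ x in S, ψ a x ∂μ) ≤
      negMulLog (μ.real S) + ∫ x in S, noise ψ x ∂μ + μ.real S * (Fintype.card ι * η) := by
  have hinteg : ∀ a, Integrable (ψ a) μ := fun a =>
    integrable_of_unit_bounds (hψ.measurable a) (hψ.nonneg a) (hψ.le_one a)
  have hintL : ∀ a, Integrable (fun x => negMulLog (ψ a x)) μ := fun a =>
    integrable_of_unit_bounds (continuous_negMulLog.measurable.comp (hψ.measurable a))
      (fun x => negMulLog_nonneg (hψ.nonneg a x) (hψ.le_one a x))
      (fun x => by linarith [negMulLog_le_one_sub_self (hψ.nonneg a x), hψ.nonneg a x])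
  rcases (measureReal_nonneg (μ := μ) (s := S)).eq_or_lt with h0 | h0
  · have : μ.restrict S = 0 := by
      rw [Measure.restrict_eq_zero]
      exact (measureReal_eq_zero_iff).1 h0.symm
    simp [this, ← h0]
  set m := μ.real S with hm
  have hsum : ∑ a, ∫ x in S, ψ a x ∂μ = m := by
    rw [← integral_finsetSum _ fun a _ => (hinteg a).integrableOn]
    simp [hψ.sum_eq_one, hm]
  have hconst : ∀ c : ℝ, ∫ _ in S, c ∂μ = m * c := fun c => by simp [hm]
  have hu : ∀ a, m * negMulLog ((∫ x in S, ψ a x ∂μ) / m) ≤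
      ∫ x in S, negMulLog (ψ a x) ∂μ + m * η := by
    intro a
    set u := (∫ x in S, ψ a x ∂μ) / m with hu
    have hu0 : 0 ≤ u := div_nonneg (integral_nonneg fun x => hψ.nonneg a x) h0.le
    have hu1 : u ≤ 1 := by
      rw [hu, div_le_one h0, ← hsum]
      exact Finset.single_le_sum (f := fun a => ∫ x in S, ψ a x ∂μ)
        (fun a _ => integral_nonneg fun x => hψ.nonneg a x) (Finset.mem_univ a)
    rw [← hconst, ← hconst, ← integral_add (hintL a).integrableOn (integrable_const _)]
    refine setIntegral_mono_on (integrable_const _)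
      ((hintL a).integrableOn.add (integrable_const _)) hS fun x hx => ?_
    refine hη u ⟨hu0, hu1⟩ _ ⟨hψ.nonneg a x, hψ.le_one a x⟩ ?_
    have h1 : u - ψ a x = (∫ y in S, (ψ a y - ψ a x) ∂μ) / m := by
      rw [integral_sub (hinteg a).integrableOn (integrable_const _), hconst, hu]
      field_simp
    rw [h1, abs_div, abs_of_pos h0, div_le_iff₀ h0]
    rw [← Real.norm_eq_abs]
    exact norm_setIntegral_le_of_norm_le_const (measure_lt_top _ _)
      fun y hy => by simpa using hosc a y hy x hx
  have hterm : ∀ a, negMulLog (∫ x in S, ψ a x ∂μ) =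
      (∫ x in S, ψ a x ∂μ) / m * negMulLog m + m * negMulLog ((∫ x in S, ψ a x ∂μ) / m) := by
    intro a
    rw [← negMulLog_mul, mul_div_cancel₀ _ h0.ne']
  have hnoise : ∫ x in S, noise ψ x ∂μ = ∑ a, ∫ x in S, negMulLog (ψ a x) ∂μ := by
    simp only [noise]
    rw [integral_finsetSum _ fun a _ => (hintL a).integrableOn]
  calc ∑ a, negMulLog (∫ x in S, ψ a x ∂μ)
      = negMulLog m + ∑ a, m * negMulLog ((∫ x in S, ψ a x ∂μ) / m) := by
        rw [Finset.sum_congr rfl fun a _ => hterm a, Finset.sum_add_distrib, ← Finset.sum_mul,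
          ← Finset.sum_div, hsum, div_self h0.ne', one_mul]
    _ ≤ negMulLog m + ∑ a, (∫ x in S, negMulLog (ψ a x) ∂μ + m * η) := by
        gcongr with a _
        exact hu a
    _ = _ := by
        rw [Finset.sum_add_distrib, hnoise]
        simp
        ring

/-- A finite measurable partition on whose cells a given coding is almost constant. -/
lemma exists_partition_oscillation_le {ψ : ι → X → ℝ} (hψ : IsObservable ψ) {δ : ℝ} (hδ : 0 < δ) :
    ∃ (k : ℕ) (P : X → Fin k), Measurable P ∧
      ∀ x y, P x = P y → ∀ a, |ψ a x - ψ a y| ≤ δ := by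
  obtain ⟨M, hM⟩ := exists_nat_gt (1 / δ)
  have hM0 : (0 : ℝ) < M := (one_div_pos.2 hδ).trans hM
  let Q : X → ι → Fin (M + 1) := fun x a => ⟨⌊M * ψ a x⌋₊, Nat.lt_succ_of_le
    (Nat.floor_le_of_le (mul_le_of_le_one_right hM0.le (hψ.le_one a x)))⟩
  have hQ : Measurable Q := by
    refine measurable_pi_lambda _ fun a => measurable_to_countable' fun j => ?_
    have : (fun x => Q x a) ⁻¹' {j} = (fun x => ⌊M * ψ a x⌋₊) ⁻¹' {(j : ℕ)} := by
      ext x; simp [Q, Fin.ext_iff]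
    rw [this]
    exact (Nat.measurable_floor.comp ((hψ.measurable a).const_mul _)) (measurableSet_singleton _)
  classical
  refine ⟨_, fun x => Fintype.equivFin (ι → Fin (M + 1)) (Q x),
    (measurable_of_countable _).comp hQ, fun x y hxy a => ?_⟩
  have h1 : ⌊M * ψ a x⌋₊ = ⌊M * ψ a y⌋₊ := by
    have := congrFun ((Fintype.equivFin _).injective hxy) a
    simpa [Q, Fin.ext_iff] using this
  have hx1 := Nat.floor_le (mul_nonneg hM0.le (hψ.nonneg a x))
  have hy1 := Nat.floor_le (mul_nonneg hM0.le (hψ.nonneg a y))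
  have hx2 := Nat.lt_floor_add_one (M * ψ a x)
  have hy2 := Nat.lt_floor_add_one (M * ψ a y)
  rw [h1] at hx1 hx2
  have h2 : 1 ≤ M * δ := by
    rw [div_lt_iff₀ hδ] at hM
    exact hM.le
  rw [abs_le]
  constructor <;> nlinarith

/-- The information carried by a random coding is bounded by the entropy of a suitable
partition, up to a small linear error. -/
lemma exists_partition_codeInfo_le {f : X → X} {μ : Measure X} [IsProbabilityMeasure μ]
    (hμ : MeasurePreserving f μ μ) {ψ : ι → X → ℝ} (hψ : IsObservable ψ) {ε : ℝ} (hε : 0 < ε) :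
    ∃ (k : ℕ) (P : X → Fin k), Measurable P ∧
      ∀ n : ℕ, codeInfo f ψ μ n ≤ partHn f μ P n + n * ε := by
  set η := ε / (Fintype.card ι + 1) with hηdef
  have hη0 : 0 < η := by positivity
  have hcard : Fintype.card ι * η ≤ ε := by
    rw [hηdef, mul_div_assoc', div_le_iff₀ (by positivity)]
    nlinarith
  obtain ⟨δ, hδ0, hδ⟩ := Metric.uniformContinuousOn_iff_le.1
    (isCompact_Icc.uniformContinuousOn_of_continuous
      (continuous_negMulLog.continuousOn (s := Icc (0 : ℝ) 1))) η hη0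
  obtain ⟨k, P, hP, hosc⟩ := exists_partition_oscillation_le hψ hδ0
  have hP' : ∀ j, MeasurableSet (P ⁻¹' {j}) := fun j => hP (measurableSet_singleton j)
  have hφ := isObservable_partObs hP'
  refine ⟨k, P, hP, fun n => ?_⟩
  have hcell : ∀ j, ∑ a, negMulLog (∫ x, partObs P j x * ψ a x ∂μ) ≤
      negMulLog (μ.real (P ⁻¹' {j})) + ∫ x, partObs P j x * noise ψ x ∂μ +
        μ.real (P ⁻¹' {j}) * (Fintype.card ι * η) := fun j => by
    simp only [integral_partObs_mul hP']
    refine sum_negMulLog_setIntegral_le hψ (hP' j) (δ := δ)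
      (fun a x hx y hy => hosc x y (hx.trans hy.symm) a) fun u hu v hv huv => ?_
    have := (abs_le.1 (hδ u hu v hv huv)).2
    linarith
  have hsum := Finset.sum_le_sum fun j (_ : j ∈ Finset.univ) => hcell j
  have hnoise : ∑ j, ∫ x, partObs P j x * noise ψ x ∂μ = ∫ x, noise ψ x ∂μ := by
    rw [← integral_finsetSum]
    · simp only [← Finset.sum_mul, hφ.sum_eq_one, one_mul]
    · intro j _
      have := ((hψ.integrable_noise_comp (μ := μ) measurable_id).indicator (hP' j))
      refine this.congr (Eventually.of_forall fun x => ?_)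
      by_cases hx : x ∈ P ⁻¹' {j} <;> simp [partObs, hx]
  have hone : ∑ j, μ.real (P ⁻¹' {j}) = 1 := by
    simp only [← integral_partObs hP']
    rw [← integral_finsetSum _ fun j _ => integrable_of_unit_bounds (hφ.measurable j)
      (hφ.nonneg j) (hφ.le_one j)]
    simp [hφ.sum_eq_one]
  rw [Finset.sum_add_distrib, Finset.sum_add_distrib, hnoise, ← Finset.sum_mul, hone] at hsum
  have hjoint := (codeEntropy_le_jointEntropy (μ := μ) hφ hψ hμ.measurable n).trans
    (jointEntropy_le hφ hψ hμ n)
  simp only [Fintype.sum_prod_type, integral_partObs hP'] at hjoint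
  have hinv : ∀ i, ∫ x, noise ψ (f^[i] x) ∂μ = ∫ x, noise ψ x ∂μ := fun i => by
    conv_rhs => rw [← map_iterate_eq hμ i]
    exact (integral_map (hμ.measurable.iterate i).aemeasurable
      hψ.measurable_noise.aestronglyMeasurable).symm
  rw [codeInfo, partHn_eq_codeEntropy hμ.measurable μ hP]
  simp only [hinv, Finset.sum_const, Finset.card_range, nsmul_eq_mul]
  have h3 : (n : ℝ) * (∑ j, ∑ a, negMulLog (∫ x, partObs P j x * ψ a x ∂μ) -
      ∑ j, negMulLog (μ.real (P ⁻¹' {j}))) ≤ n * (∫ x, noise ψ x ∂μ + ε) :=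
    mul_le_mul_of_nonneg_left (by linarith) (Nat.cast_nonneg n)
  linarith

/-- If a random coding carries information at rate at least `s`, so does the metric entropy. -/
lemma le_ksEnt_of_le_codeInfo {f : X → X} {μ : Measure X} [IsProbabilityMeasure μ]
    (hμ : MeasurePreserving f μ μ) {ψ : ι → X → ℝ} (hψ : IsObservable ψ) {s : ℝ}
    (hs : ∀ n : ℕ, n * s ≤ codeInfo f ψ μ n) : (s : EReal) ≤ ksEnt f μ := by
  refine EReal.ge_of_forall_gt_iff_ge.1 fun t ht => ?_
  have ht : t < s := by exact_mod_cast ht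
  obtain ⟨k, P, hP, hle⟩ := exists_partition_codeInfo_le hμ hψ (sub_pos.2 ht)
  refine le_trans ?_ (le_iSup₂_of_le k P (le_iSup_of_le hP le_rfl))
  rw [EReal.coe_le_coe_iff]
  refine le_ciInf fun n => ?_
  have h := (hs (n + 1)).trans (hle (n + 1))
  push_cast at h
  rw [le_div_iff₀ (by positivity)]
  linarith

end PartitionCoding

section EntropyLeTopEnt

open Real

variable {X : Type*} [MetricSpace X]

lemma isOpen_dynBall {f : X → X} (hf : Continuous f) (x : X) (n : ℕ) (r : ℝ) :
    IsOpen (dynBall f x n r) := by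
  have : dynBall f x n r = ⋂ i : Fin n, {y | dist (f^[(i : ℕ)] x) (f^[(i : ℕ)] y) < r} := by
    ext y
    simp [dynBall, Fin.forall_iff]
  rw [this]
  exact isOpen_iInter_of_finite fun i =>
    isOpen_lt (continuous_const.dist (hf.iterate i)) continuous_const

lemma bddAbove_card_isDynSep [CompactSpace X] {f : X → X} (hf : Continuous f) (E : Set X) (n : ℕ)
    {ε : ℝ} (hε : 0 < ε) : BddAbove {k | ∃ S : Finset X, IsDynSep f E n ε ↑S ∧ S.card = k} := by
  obtain ⟨t, ht⟩ := isCompact_univ.elim_finite_subcover (fun x => dynBall f x n (ε / 2))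
    (fun x => isOpen_dynBall hf x n _) fun x _ => mem_iUnion.2 ⟨x, fun i _ => by simpa using hε⟩
  have hc : ∀ x, ∃ y ∈ t, x ∈ dynBall f y n (ε / 2) := fun x => by
    simpa using ht (mem_univ x)
  choose c hct hc using hc
  refine ⟨t.card, ?_⟩
  rintro k ⟨S, hS, rfl⟩
  refine Finset.card_le_card_of_injOn c (fun x _ => hct x) fun x hx y hy hxy => ?_
  by_contra hne
  obtain ⟨i, hi, hlt⟩ := hS.2 x hx y hy hne
  have h1 := hc x i hi
  have h2 := hc y i hi
  rw [← hxy] at h2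
  linarith [dist_triangle_left (f^[i] x) (f^[i] y) (f^[i] (c x))]

/-- A maximal separated set is spanning. -/
lemma exists_spanning_card_eq_sepCount [CompactSpace X] {f : X → X} (hf : Continuous f) (n : ℕ)
    {ε : ℝ} (hε : 0 < ε) : ∃ S : Finset X, S.card = sepCount f univ n ε ∧
      ∀ x, ∃ e ∈ S, ∀ i < n, dist (f^[i] e) (f^[i] x) ≤ ε := by
  have hb := bddAbove_card_isDynSep hf univ n hε
  have hne : {k | ∃ S : Finset X, IsDynSep f univ n ε ↑S ∧ S.card = k}.Nonempty :=
    ⟨0, ∅, by simp [IsDynSep], rfl⟩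
  obtain ⟨S, hS, hcard⟩ := Nat.sSup_mem hne hb
  refine ⟨S, hcard, fun x => ?_⟩
  by_contra! hx
  have hxS : x ∉ S := fun h => by
    obtain ⟨i, _, hi⟩ := hx x h
    rw [dist_self] at hi
    linarith
  have hS' : IsDynSep f univ n ε ↑(Finset.cons x S hxS) := by
    refine ⟨subset_univ _, fun a ha b hb hab => ?_⟩
    simp only [Finset.coe_cons, mem_insert_iff, Finset.mem_coe] at ha hb
    rcases ha with rfl | ha <;> rcases hb with rfl | hb
    · exact absurd rfl hab
    · obtain ⟨i, hi, h⟩ := hx b hb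
      exact ⟨i, hi, by rwa [dist_comm]⟩
    · exact hx a ha
    · exact hS.2 a ha b hb hab
  have := le_csSup hb ⟨_, hS', rfl⟩
  rw [Finset.card_cons, hcard] at this
  omega

/-- If each word of a partition `R` is compatible with at most `N` words of a partition `P`, then
the entropies of the words differ by at most `log N`. -/
lemma codeEntropy_partObs_le_add_log {X ι κ : Type*} [MeasurableSpace X] [Fintype ι] [Fintype κ]
    {f : X → X} (hf : Measurable f) {μ : Measure X} [IsProbabilityMeasure μ] {P : X → ι}
    {R : X → κ} (hP : ∀ j, MeasurableSet (P ⁻¹' {j})) (hR : ∀ j, MeasurableSet (R ⁻¹' {j}))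
    {n N : ℕ} (S : (Fin n → κ) → Finset (Fin n → ι)) (hcard : ∀ r, (S r).card ≤ N)
    (hS : ∀ x, (fun i : Fin n => P (f^[(i : ℕ)] x)) ∈ S fun i => R (f^[(i : ℕ)] x)) :
    codeEntropy f (partObs P) μ n ≤ codeEntropy f (partObs R) μ n + log N := by
  have oP := isObservable_partObs hP
  have oR := isObservable_partObs hR
  refine (codeEntropy_le_jointEntropy oR oP hf n).trans ?_
  rw [jointEntropy, Fintype.sum_prod_type]
  have hzero : ∀ d c, c ∉ S d →
      ∫ x, codeWeight f (partObs R) n d x * codeWeight f (partObs P) n c x ∂μ = 0 := by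
    intro d c hc
    refine integral_eq_zero_of_ae (Eventually.of_forall fun x => ?_)
    simp only [codeWeight_partObs, Pi.zero_apply, mul_eq_zero, indicator_apply_eq_zero,
      mem_ofPred_eq, Pi.one_apply, one_ne_zero, imp_false]
    by_contra! h
    refine hc ?_
    have := hS x
    rwa [show (fun i : Fin n => P (f^[(i : ℕ)] x)) = c from funext h.2,
      show (fun i : Fin n => R (f^[(i : ℕ)] x)) = d from funext h.1] at this
  have hd : ∀ d, ∑ c, negMulLog
      (∫ x, codeWeight f (partObs R) n d x * codeWeight f (partObs P) n c x ∂μ) ≤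
      negMulLog (∫ x, codeWeight f (partObs R) n d x ∂μ) +
        (∫ x, codeWeight f (partObs R) n d x ∂μ) * log N := by
    intro d
    rw [← sum_integral_codeWeight_mul_right oR oP hf n d,
      ← Finset.sum_subset (Finset.subset_univ (S d)) fun c _ hc => hzero d c hc,
      ← Finset.sum_subset (Finset.subset_univ (S d)) fun c _ hc => by
        rw [hzero d c hc, negMulLog_zero]]
    exact sum_negMulLog_le_of_card_le _ _ (fun c _ => integral_nonneg fun x =>
      mul_nonneg (oR.codeWeight_nonneg _ _ _) (oP.codeWeight_nonneg _ _ _)) (hcard d)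
  refine (Finset.sum_le_sum fun d _ => hd d).trans (le_of_eq ?_)
  rw [Finset.sum_add_distrib, ← Finset.sum_mul,
    ← integral_finsetSum _ fun d _ => oR.integrable_codeWeight hf n d]
  simp [oR.sum_codeWeight, codeEntropy]

/-- The words of a partition `P` are controlled by Bowen balls and by the visits to the complement
of compact subsets of the cells. -/
lemma exists_pos_codeEntropy_le_log_sepCount [CompactSpace X] [MeasurableSpace X] [BorelSpace X]
    {f : X → X} (hf : Continuous f) {μ : Measure X} [IsProbabilityMeasure μ] {k : ℕ}
    {P : X → Fin k} (hP : Measurable P) {K : Fin k → Set X} (hK : ∀ j, IsClosed (K j))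
    (hKP : ∀ j, K j ⊆ P ⁻¹' {j}) {R : X → Option (Fin k)}
    (hR : ∀ r, MeasurableSet (R ⁻¹' {r})) (hRnone : ∀ x, R x = none → x ∈ K (P x))
    (hRsome : ∀ x j, R x = some j → P x = j) :
    ∃ ε > 0, ∀ n, codeEntropy f (partObs P) μ n ≤
      codeEntropy f (partObs R) μ n + log (sepCount f univ n ε) := by
  have hopen : ∀ j, IsOpen (⋃ i ∈ {i | i ≠ j}, K i)ᶜ := fun j =>
    ((Set.toFinite _).isClosed_biUnion fun i _ => hK i).isOpen_compl
  have hcover : (univ : Set X) ⊆ ⋃ j, (⋃ i ∈ {i | i ≠ j}, K i)ᶜ := by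
    intro x _
    refine mem_iUnion.2 ⟨P x, fun h => ?_⟩
    simp only [mem_iUnion, mem_ofPred_eq] at h
    obtain ⟨i, hi, hx⟩ := h
    exact hi (hKP i hx).symm
  obtain ⟨δ, hδ, hball⟩ := lebesgue_number_lemma_of_metric isCompact_univ hopen hcover
  choose g hg using fun x => hball x (mem_univ x)
  have hgK : ∀ e x, dist e x < δ → R x = none → P x = g e := by
    intro e x hex hx
    by_contra hne
    refine hg e (Metric.mem_ball'.2 hex) ?_
    simp only [mem_iUnion, mem_ofPred_eq]
    exact ⟨P x, hne, hRnone x hx⟩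
  refine ⟨δ / 2, half_pos hδ, fun n => ?_⟩
  obtain ⟨S, hcard, hspan⟩ := exists_spanning_card_eq_sepCount hf n (half_pos hδ)
  classical
  refine codeEntropy_partObs_le_add_log hf.measurable (fun j => hP (measurableSet_singleton j)) hR
    (fun r => S.image fun e i => (r i).getD (g (f^[(i : ℕ)] e)))
    (fun r => Finset.card_image_le.trans hcard.le) fun x => ?_
  obtain ⟨e, he, hd⟩ := hspan x
  refine Finset.mem_image.2 ⟨e, he, funext fun i => ?_⟩
  change (R (f^[(i : ℕ)] x)).getD _ = _
  rcases h : R (f^[(i : ℕ)] x) with _ | j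
  · exact (hgK _ _ (by linarith [hd i i.2]) h).symm
  · exact (hRsome _ _ h).symm

/-- A measurable partition can be shrunk to compact sets, losing arbitrarily little entropy. -/
lemma exists_compact_approx [CompactSpace X] [MeasurableSpace X] [BorelSpace X]
    (μ : Measure X) [IsProbabilityMeasure μ] {k : ℕ}
    {P : X → Fin k} (hP : Measurable P) {η : ℝ} (hη : 0 < η) :
    ∃ (K : Fin k → Set X) (R : X → Option (Fin k)), (∀ j, IsClosed (K j)) ∧
      (∀ j, K j ⊆ P ⁻¹' {j}) ∧ (∀ r, MeasurableSet (R ⁻¹' {r})) ∧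
      (∀ x, R x = none → x ∈ K (P x)) ∧ (∀ x j, R x = some j → P x = j) ∧
      ∑ r, negMulLog (∫ x, partObs R r x ∂μ) ≤ η := by
  set η' := η / (2 * k + 1) with hη'
  have hη'0 : 0 < η' := by positivity
  have hη'1 : k * η' + k * η' ≤ η := by
    have : η' * (2 * k + 1) = η := div_mul_cancel₀ _ (by positivity)
    nlinarith
  obtain ⟨δ, hδ, hδη⟩ := Metric.continuous_iff.1 continuous_negMulLog 0 η' hη'0
  set δ' := min (δ / 2) η' with hδ'
  have hδ'0 : 0 < δ' := lt_min (half_pos hδ) hη'0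
  have hP' : ∀ j, MeasurableSet (P ⁻¹' {j}) := fun j => hP (measurableSet_singleton j)
  choose K hKP hK hKμ using fun j => (hP' j).exists_isClosed_sdiff_lt (μ := μ)
    (measure_ne_top _ _) (ε := ENNReal.ofReal δ') (by simpa using hδ'0)
  have hKμ' : ∀ j, μ.real (P ⁻¹' {j} \ K j) ≤ δ' := fun j =>
    ENNReal.toReal_le_of_le_ofReal hδ'0.le (hKμ j).le
  classical
  set R : X → Option (Fin k) := fun x => if x ∈ K (P x) then none else some (P x) with hR
  have hRsome : ∀ j, R ⁻¹' {some j} = P ⁻¹' {j} \ K j := by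
    intro j
    ext x
    simp only [hR, mem_preimage, mem_singleton_iff, Set.mem_sdiff]
    split_ifs with h
    · simp only [false_iff, not_and, not_not]
      rintro rfl
      exact h
    · simp only [Option.some.injEq]
      exact ⟨fun hj => ⟨hj, hj ▸ h⟩, fun hj => hj.1⟩
  have hRnone : R ⁻¹' {none} = (⋃ j, P ⁻¹' {j} \ K j)ᶜ := by
    ext x
    simp [hR]
  have hms : ∀ j, MeasurableSet (P ⁻¹' {j} \ K j) := fun j => (hP' j).diff (hK j).measurableSet
  have hRm : ∀ r, MeasurableSet (R ⁻¹' {r}) := by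
    rintro (_ | j)
    · rw [hRnone]
      exact (MeasurableSet.iUnion hms).compl
    · rw [hRsome]
      exact hms j
  refine ⟨K, R, hK, hKP, hRm, fun x hx => ?_, fun x j hx => ?_, ?_⟩
  · by_contra h
    simp [hR, h] at hx
  · have : x ∈ R ⁻¹' {some j} := hx
    rw [hRsome] at this
    exact this.1
  · simp only [integral_partObs hRm, Fintype.sum_option, hRsome]
    have h1 : negMulLog (μ.real (R ⁻¹' {none})) ≤ k * η' := by
      refine (negMulLog_le_one_sub_self measureReal_nonneg).trans ?_
      rw [hRnone, probReal_compl_eq_one_sub (MeasurableSet.iUnion hms), sub_sub_cancel]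
      refine (measureReal_iUnion_fintype_le _).trans ?_
      refine (Finset.sum_le_card_nsmul _ _ η' fun j _ =>
        (hKμ' j).trans (min_le_right _ _)).trans (by simp)
    have h2 : ∑ j, negMulLog (μ.real (P ⁻¹' {j} \ K j)) ≤ k * η' := by
      refine (Finset.sum_le_card_nsmul _ _ η' fun j _ => ?_).trans (by simp)
      have h3 := hδη (μ.real (P ⁻¹' {j} \ K j)) (by
        rw [Real.dist_eq, sub_zero, abs_of_nonneg measureReal_nonneg]
        linarith [hKμ' j, min_le_left (δ / 2) η'])
      rw [negMulLog_zero, Real.dist_eq, sub_zero] at h3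
      exact (le_abs_self _).trans h3.le
    linarith

/-- One half of the variational principle: metric entropy is bounded by topological entropy. -/
theorem ksEnt_le_topEnt [CompactSpace X] [MeasurableSpace X] [BorelSpace X]
    {f : X → X} (hf : Continuous f) {μ : Measure X} [IsProbabilityMeasure μ]
    (hμ : MeasurePreserving f μ μ) : ksEnt f μ ≤ topEnt f univ := by
  refine iSup_le fun k => iSup_le fun P => iSup_le fun hP => ?_
  refine EReal.ge_of_forall_gt_iff_ge.1 fun t ht => ?_
  have ht : t < ⨅ n : ℕ, partHn f μ P (n + 1) / ((n : ℝ) + 1) := by exact_mod_cast ht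
  have hP' : ∀ j, MeasurableSet (P ⁻¹' {j}) := fun j => hP (measurableSet_singleton j)
  obtain ⟨K, R, hK, hKP, hR, hRn, hRs, hH⟩ := exists_compact_approx μ hP (sub_pos.2 ht)
  obtain ⟨ε, hε, hle⟩ := exists_pos_codeEntropy_le_log_sepCount (μ := μ) hf hP hK hKP hR hRn hRs
  have hbdd : BddBelow (range fun n : ℕ => partHn f μ P (n + 1) / ((n : ℝ) + 1)) := by
    refine ⟨0, ?_⟩
    rintro _ ⟨n, rfl⟩
    have := (isObservable_partObs hP').codeEntropy_nonneg (μ := μ) hf.measurable (n + 1)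
    rw [← partHn_eq_codeEntropy hf.measurable μ hP] at this
    positivity
  have hev : ∀ n : ℕ, t ≤ log (sepCount f univ (n + 1) ε) / ((n + 1 : ℕ) : ℝ) := by
    intro n
    have h1 := ciInf_le hbdd n
    have h2 := hle (n + 1)
    rw [← partHn_eq_codeEntropy hf.measurable μ hP] at h2
    have h3 := codeEntropy_le_mul (isObservable_partObs hR) hμ (n + 1)
    have h4 := mul_le_mul_of_nonneg_left hH (Nat.cast_nonneg (α := ℝ) (n + 1))
    rw [le_div_iff₀ (by positivity)] at h1 ⊢
    push_cast at h3 h4 ⊢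
    linarith
  refine le_trans ?_ (le_iSup₂_of_le univ isCompact_univ (le_iSup_of_le subset_rfl
    (le_iSup₂_of_le ε hε le_rfl)))
  refine le_limsup_of_frequently_le' (Eventually.frequently ?_)
  filter_upwards [eventually_ge_atTop 1] with n hn
  obtain ⟨m, rfl⟩ := Nat.exists_eq_add_of_le' hn
  exact_mod_cast hev m

end EntropyLeTopEnt

section Mixture

open Real

variable {X T ι : Type*} [MeasurableSpace X] [Fintype T] [Fintype ι]

/-- The mixture of the measures `ν i` with weights `w i`. -/
noncomputable def mixture (w : T → ℝ) (ν : T → Measure X) : Measure X :=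
  ∑ i, ENNReal.ofReal (w i) • ν i

variable {w : T → ℝ} {ν : T → Measure X} {f : X → X} {ψ : ι → X → ℝ}

lemma isProbabilityMeasure_mixture [∀ i, IsProbabilityMeasure (ν i)] (hw : ∀ i, 0 ≤ w i)
    (hsum : ∑ i, w i = 1) : IsProbabilityMeasure (mixture w ν) :=
  ⟨by simp [mixture, ← ENNReal.ofReal_sum_of_nonneg fun i _ => hw i, hsum]⟩

lemma integral_mixture (hw : ∀ i, 0 ≤ w i) {g : X → ℝ} (hg : ∀ i, Integrable g (ν i)) :
    ∫ x, g x ∂mixture w ν = ∑ i, w i * ∫ x, g x ∂ν i := by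
  rw [mixture, integral_finsetSum_measure fun i _ => (hg i).smul_measure ENNReal.ofReal_ne_top]
  refine Finset.sum_congr rfl fun i _ => ?_
  rw [integral_smul_measure, ENNReal.toReal_ofReal (hw i), smul_eq_mul]

variable [∀ i, IsProbabilityMeasure (ν i)]

lemma codeEntropy_mixture (hψ : IsObservable ψ) (hf : Measurable f) (hw : ∀ i, 0 ≤ w i) (n : ℕ) :
    codeEntropy f ψ (mixture w ν) n =
      ∑ c : Fin n → ι, negMulLog (∑ i, w i * ∫ x, codeWeight f ψ n c x ∂ν i) :=
  Finset.sum_congr rfl fun c _ => by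
    rw [integral_mixture hw fun i => hψ.integrable_codeWeight hf n c]

lemma sum_integral_noise_mixture (hψ : IsObservable ψ) (hf : Measurable f) (hw : ∀ i, 0 ≤ w i)
    (n : ℕ) : ∑ i ∈ Finset.range n, ∫ x, noise ψ (f^[i] x) ∂mixture w ν =
      ∑ j, w j * ∑ i ∈ Finset.range n, ∫ x, noise ψ (f^[i] x) ∂ν j := by
  simp only [Finset.mul_sum]
  rw [Finset.sum_comm]
  exact Finset.sum_congr rfl fun i _ =>
    integral_mixture hw fun j => hψ.integrable_noise_comp (hf.iterate i)

/-- The information of a coding is a concave function of the measure. -/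
lemma sum_mul_codeInfo_le_codeInfo_mixture (hψ : IsObservable ψ) (hf : Measurable f)
    (hw : ∀ i, 0 ≤ w i) (hsum : ∑ i, w i = 1) (n : ℕ) :
    ∑ i, w i * codeInfo f ψ (ν i) n ≤ codeInfo f ψ (mixture w ν) n := by
  simp only [codeInfo, mul_sub, Finset.sum_sub_distrib, sum_integral_noise_mixture hψ hf hw n]
  gcongr
  rw [codeEntropy_mixture hψ hf hw]
  simp only [codeEntropy, Finset.mul_sum]
  rw [Finset.sum_comm]
  refine Finset.sum_le_sum fun c _ => ?_
  have h := concaveOn_negMulLog.le_map_sum (t := Finset.univ) (w := w)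
    (p := fun i => ∫ x, codeWeight f ψ n c x ∂ν i) (fun i _ => hw i) hsum
    fun i _ => hψ.integral_codeWeight_nonneg n c
  simpa only [smul_eq_mul] using h

lemma sum_negMulLog_mul_integral_codeWeight (hψ : IsObservable ψ) (hf : Measurable f) (n : ℕ) :
    ∑ c : Fin n → ι, ∑ i, negMulLog (w i * ∫ x, codeWeight f ψ n c x ∂ν i) =
      ∑ i, w i * codeEntropy f ψ (ν i) n + ∑ i, negMulLog (w i) := by
  rw [Finset.sum_comm, ← Finset.sum_add_distrib]
  refine Finset.sum_congr rfl fun i _ => ?_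
  simp only [negMulLog_mul, Finset.sum_add_distrib, codeEntropy, ← Finset.mul_sum,
    ← Finset.sum_mul]
  rw [← integral_finsetSum _ fun c _ => hψ.integrable_codeWeight hf n c]
  simp [hψ.sum_codeWeight, add_comm]

/-- The information of a coding is a convex function of the measure, up to the entropy of the
weights. -/
lemma codeInfo_mixture_le (hψ : IsObservable ψ) (hf : Measurable f) (hw : ∀ i, 0 ≤ w i)
    (n : ℕ) : codeInfo f ψ (mixture w ν) n ≤
      ∑ i, w i * codeInfo f ψ (ν i) n + ∑ i, negMulLog (w i) := by
  simp only [codeInfo, mul_sub, Finset.sum_sub_distrib, sum_integral_noise_mixture hψ hf hw n]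
  have h : codeEntropy f ψ (mixture w ν) n ≤
      ∑ i, w i * codeEntropy f ψ (ν i) n + ∑ i, negMulLog (w i) := by
    rw [codeEntropy_mixture hψ hf hw, ← sum_negMulLog_mul_integral_codeWeight hψ hf]
    exact Finset.sum_le_sum fun c _ => negMulLog_sum_le _ _ fun i _ =>
      mul_nonneg (hw i) (hψ.integral_codeWeight_nonneg n c)
  linarith

/-- If each word can only arise from one component of a mixture, then the entropy of the weights
is fully detected by the coding. -/
lemma codeInfo_mixture_eq (hψ : IsObservable ψ) (hf : Measurable f) (hw : ∀ i, 0 ≤ w i)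
    {n : ℕ} (h : ∀ c : Fin n → ι, ∀ i j, ∫ x, codeWeight f ψ n c x ∂ν i ≠ 0 →
      ∫ x, codeWeight f ψ n c x ∂ν j ≠ 0 → i = j) :
    codeInfo f ψ (mixture w ν) n =
      ∑ i, w i * codeInfo f ψ (ν i) n + ∑ i, negMulLog (w i) := by
  simp only [codeInfo, mul_sub, Finset.sum_sub_distrib, sum_integral_noise_mixture hψ hf hw n]
  have h : codeEntropy f ψ (mixture w ν) n =
      ∑ i, w i * codeEntropy f ψ (ν i) n + ∑ i, negMulLog (w i) := by
    rw [codeEntropy_mixture hψ hf hw, ← sum_negMulLog_mul_integral_codeWeight hψ hf]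
    refine Finset.sum_congr rfl fun c _ => ?_
    by_cases hc : ∃ i, ∫ x, codeWeight f ψ n c x ∂ν i ≠ 0
    · obtain ⟨i, hi⟩ := hc
      have h0 : ∀ j, j ≠ i → ∫ x, codeWeight f ψ n c x ∂ν j = 0 := fun j hj => by
        by_contra hne
        exact hj (h c j i hne hi)
      rw [Fintype.sum_eq_single i fun j hj => by rw [h0 j hj, mul_zero],
        Fintype.sum_eq_single i fun j hj => by rw [h0 j hj, mul_zero, negMulLog_zero]]
    · push Not at hc
      simp [hc]
  linarith

end Mixture

section SeparatedSets

open Real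

variable {X ι : Type*} [MeasurableSpace X] [Fintype ι] {f : X → X} {ψ : ι → X → ℝ}

lemma codeEntropy_dirac (hψ : IsObservable ψ) (hf : Measurable f) (x : X) (n : ℕ) :
    codeEntropy f ψ (Measure.dirac x) n = ∑ i ∈ Finset.range n, noise ψ (f^[i] x) := by
  have h : ∀ n, codeEntropy f ψ (Measure.dirac x) n =
      ∑ c : Fin n → ι, negMulLog (codeWeight f ψ n c x) := fun n =>
    Finset.sum_congr rfl fun c _ => by
      rw [integral_dirac' _ _ (hψ.measurable_codeWeight hf n c).stronglyMeasurable]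
  induction n with
  | zero => simp [codeEntropy_zero]
  | succ n ih =>
    rw [Finset.sum_range_succ, ← ih, h, h,
      ← (Fin.snocEquiv fun _ : Fin (n + 1) => ι).sum_comp, Fintype.sum_prod_type_right]
    have : ∀ c : Fin n → ι, ∑ a, negMulLog (codeWeight f ψ (n + 1)
        ((Fin.snocEquiv fun _ : Fin (n + 1) => ι) (a, c)) x) =
        negMulLog (codeWeight f ψ n c x) + codeWeight f ψ n c x * noise ψ (f^[n] x) := by
      intro c
      simp only [Fin.snocEquiv, Equiv.coe_fn_mk, codeWeight_snoc, negMulLog_mul,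
        Finset.sum_add_distrib, ← Finset.sum_mul, ← Finset.mul_sum, hψ.sum_eq_one, one_mul, noise]
    rw [Finset.sum_congr rfl fun c _ => this c, Finset.sum_add_distrib, ← Finset.sum_mul,
      hψ.sum_codeWeight, one_mul]

lemma codeInfo_dirac (hψ : IsObservable ψ) (hf : Measurable f) (x : X) (n : ℕ) :
    codeInfo f ψ (Measure.dirac x) n = 0 := by
  rw [codeInfo, codeEntropy_dirac hψ hf, sub_eq_zero]
  exact Finset.sum_congr rfl fun i _ => (integral_dirac' _ _
    (hψ.measurable_noise.comp (hf.iterate i)).stronglyMeasurable).symm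

lemma codeInfo_le_card (hψ : IsObservable ψ)
    (μ : Measure X) (n : ℕ) :
    codeInfo f ψ μ n ≤ Fintype.card (Fin n → ι) := by
  have h1 : codeEntropy f ψ μ n ≤ Fintype.card (Fin n → ι) := by
    refine (Finset.sum_le_card_nsmul _ _ 1 fun c _ => ?_).trans (by simp)
    linarith [negMulLog_le_one_sub_self (hψ.integral_codeWeight_nonneg (f := f) (μ := μ) n c),
      hψ.integral_codeWeight_nonneg (f := f) (μ := μ) n c]
  have h2 : 0 ≤ ∑ i ∈ Finset.range n, ∫ x, noise ψ (f^[i] x) ∂μ :=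
    Finset.sum_nonneg fun i _ => integral_nonneg fun x => hψ.noise_nonneg _
  rw [codeInfo]
  linarith

/-- Information along long words is bounded by the information in short blocks, summed over all
starting times. -/
lemma sum_codeInfo_add_le (hψ : IsObservable ψ) (hf : Measurable f) (μ : Measure X)
    [IsProbabilityMeasure μ] (m n : ℕ) :
    ∑ j ∈ Finset.range m, codeInfo f ψ μ (n + j) ≤
      ∑ t ∈ Finset.range n, codeInfo f ψ (μ.map f^[t]) m +
        ∑ j ∈ Finset.range m, codeInfo f ψ μ j := by
  induction n with
  | zero => simp
  | succ n ih =>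
    have h := codeInfo_add_le (μ := μ) hψ hf n m
    have h1 := Finset.sum_range_succ (fun j => codeInfo f ψ μ (n + j)) m
    rw [Finset.sum_range_succ'] at h1
    rw [Finset.sum_range_succ]
    simp only [add_zero] at h1
    have h2 : ∑ j ∈ Finset.range m, codeInfo f ψ μ (n + 1 + j) =
        ∑ j ∈ Finset.range m, codeInfo f ψ μ (n + (j + 1)) :=
      Finset.sum_congr rfl fun j _ => by rw [add_right_comm, add_assoc]
    linarith

end SeparatedSets

section EmpiricalMeasures

open Real

variable {X ι : Type*} [MetricSpace X] {f : X → X}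

lemma IsDynSep.mono {E : Set X} {n n' : ℕ} {ε : ℝ} {S : Set X} (hS : IsDynSep f E n ε S)
    (h : n ≤ n') : IsDynSep f E n' ε S :=
  ⟨hS.1, fun x hx y hy hxy => by
    obtain ⟨i, hi, hlt⟩ := hS.2 x hx y hy hxy
    exact ⟨i, hi.trans_le h, hlt⟩⟩

variable [MeasurableSpace X] [Fintype ι] {ψ : ι → X → ℝ}

/-- The uniform measure on a separated set is completely resolved by a coding that separates
points at distance larger than `ε`. -/
lemma codeInfo_uniform_of_isDynSep (hψ : IsObservable ψ) (hf : Measurable f) {ε : ℝ}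
    (hsupp : ∀ a x y, ψ a x ≠ 0 → ψ a y ≠ 0 → dist x y ≤ ε) {n : ℕ} {S : Finset X}
    (hS : IsDynSep f univ n ε ↑S) :
    codeInfo f ψ (mixture (fun _ : S => (S.card : ℝ)⁻¹) fun x => Measure.dirac (x : X)) n =
      log S.card := by
  rw [codeInfo_mixture_eq hψ hf fun _ => by positivity]
  · rcases S.eq_empty_or_nonempty with rfl | hne
    · simp
    · have hpos : (S.card : ℝ) ≠ 0 := by simpa using hne.ne_empty
      simp [codeInfo_dirac hψ hf, negMulLog]
      field_simp
  · intro c x y hx hy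
    have hd : ∀ z : X, ∫ x, codeWeight f ψ n c x ∂Measure.dirac z = codeWeight f ψ n c z :=
      fun z => integral_dirac' _ _ (hψ.measurable_codeWeight hf n c).stronglyMeasurable
    rw [hd, codeWeight, Finset.prod_ne_zero_iff] at hx hy
    by_contra hne
    obtain ⟨i, hi, hlt⟩ := hS.2 x x.2 y y.2 fun h => hne (Subtype.ext h)
    exact hlt.not_ge (hsupp _ _ _ (hx ⟨i, hi⟩ (Finset.mem_univ _)) (hy ⟨i, hi⟩ (Finset.mem_univ _)))

variable [BorelSpace X]

/-- A separated set gives rise to an almost invariant measure with large information. -/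
lemma exists_probabilityMeasure_of_isDynSep [CompactSpace X] (hψ : IsObservable ψ)
    (hf : Continuous f) {ε : ℝ}
    (hsupp : ∀ a x y, ψ a x ≠ 0 → ψ a y ≠ 0 → dist x y ≤ ε) {n : ℕ} (hn : 0 < n) {S : Finset X}
    (hS : IsDynSep f univ n ε ↑S) (hne : S.Nonempty) :
    ∃ μ : ProbabilityMeasure X,
      (∀ m : ℕ, m * log S.card / n ≤ codeInfo f ψ μ m +
        (∑ j ∈ Finset.range m, (Fintype.card (Fin j → ι) : ℝ)) / n) ∧
      ∀ g : C(X, ℝ), |∫ x, g (f x) ∂(μ : Measure X) - ∫ x, g x ∂(μ : Measure X)| ≤ 2 * ‖g‖ / n := by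
  have hfm := hf.measurable
  have hn' : (0 : ℝ) < n := by exact_mod_cast hn
  set ν := mixture (fun _ : S => (S.card : ℝ)⁻¹) fun x => Measure.dirac (x : X) with hν
  have hνp : IsProbabilityMeasure ν := isProbabilityMeasure_mixture (fun _ => by positivity) (by
    have : (S.card : ℝ) ≠ 0 := by simpa using hne.ne_empty
    simp [this])
  have hνt : ∀ t, IsProbabilityMeasure (ν.map f^[t]) := fun t =>
    Measure.isProbabilityMeasure_map (hfm.iterate t).aemeasurable
  have hw : ∀ i : Fin n, (0 : ℝ) ≤ (fun _ : Fin n => (n : ℝ)⁻¹) i := fun _ => by positivity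
  have hw1 : ∑ i : Fin n, (fun _ : Fin n => (n : ℝ)⁻¹) i = 1 := by simp [hn'.ne']
  set μ := mixture (fun _ : Fin n => (n : ℝ)⁻¹) fun t : Fin n => ν.map f^[(t : ℕ)] with hμ
  have hμp : IsProbabilityMeasure μ := isProbabilityMeasure_mixture hw hw1
  refine ⟨⟨μ, hμp⟩, fun m => ?_, fun g => ?_⟩
  · have h1 := sum_mul_codeInfo_le_codeInfo_mixture
      (ν := fun t : Fin n => ν.map f^[(t : ℕ)]) hψ hfm hw hw1 m
    rw [← Finset.mul_sum, Fin.sum_univ_eq_sum_range fun t => codeInfo f ψ (ν.map f^[t]) m] at h1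
    have h2 := sum_codeInfo_add_le hψ hfm ν m n
    have h3 : ∑ j ∈ Finset.range m, codeInfo f ψ ν (n + j) = m * log S.card := by
      rw [Finset.sum_congr rfl fun j _ => codeInfo_uniform_of_isDynSep hψ hfm hsupp
        (hS.mono (Nat.le_add_right n j))]
      simp
    have h4 : ∑ j ∈ Finset.range m, codeInfo f ψ ν j ≤
        ∑ j ∈ Finset.range m, (Fintype.card (Fin j → ι) : ℝ) :=
      Finset.sum_le_sum fun j _ => codeInfo_le_card hψ ν j
    change _ ≤ codeInfo f ψ μ m + _
    rw [inv_mul_le_iff₀ hn'] at h1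
    rw [div_le_iff₀ hn', add_mul, div_mul_cancel₀ _ hn'.ne']
    linarith
  · have hinteg : ∀ (h : C(X, ℝ)) (ρ : Measure X) [IsProbabilityMeasure ρ], Integrable h ρ :=
      fun h ρ _ => h.continuous.integrable_of_hasCompactSupport
        (HasCompactSupport.of_compactSpace _)
    have hgt : ∀ h : C(X, ℝ), ∫ x, h x ∂μ =
        (n : ℝ)⁻¹ * ∑ t ∈ Finset.range n, ∫ x, h (f^[t] x) ∂ν := by
      intro h
      rw [hμ, integral_mixture hw fun i => hinteg h _, ← Finset.mul_sum,
        Fin.sum_univ_eq_sum_range fun t => ∫ x, h x ∂(ν.map f^[t])]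
      congr 1
      refine Finset.sum_congr rfl fun t _ => ?_
      rw [integral_map (hfm.iterate t).aemeasurable h.continuous.aestronglyMeasurable]
    change |∫ x, g (f x) ∂μ - ∫ x, g x ∂μ| ≤ _
    have h1 : ∫ x, g (f x) ∂μ = (n : ℝ)⁻¹ * ∑ t ∈ Finset.range n, ∫ x, g (f^[t + 1] x) ∂ν := by
      simp only [Function.iterate_succ_apply']
      exact hgt (g.comp ⟨f, hf⟩)
    have h2 : ∀ t, |∫ x, g (f^[t] x) ∂ν| ≤ ‖g‖ := fun t => by
      have := norm_integral_le_of_norm_le_const (μ := ν) (f := fun x => g (f^[t] x)) (C := ‖g‖)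
        (Eventually.of_forall fun x => g.norm_coe_le_norm _)
      simpa using this
    rw [h1, hgt g, ← mul_sub, ← Finset.sum_sub_distrib,
      Finset.sum_range_sub (fun t => ∫ x, g (f^[t] x) ∂ν), abs_mul, abs_of_nonneg (by positivity),
      inv_mul_eq_div]
    gcongr
    linarith [abs_sub (∫ x, g (f^[n] x) ∂ν) (∫ x, g (f^[0] x) ∂ν), h2 n, h2 0]

/-- Invariant probability measures, characterised by continuous test functions. -/
lemma measurePreserving_of_forall_integral_eq (hf : Continuous f) (μ : Measure X)
    [IsFiniteMeasure μ] (h : ∀ g : BoundedContinuousFunction X ℝ, ∫ x, g (f x) ∂μ = ∫ x, g x ∂μ) :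
    MeasurePreserving f μ μ := by
  refine ⟨hf.measurable, ?_⟩
  refine ext_of_forall_integral_eq_of_IsFiniteMeasure fun g => ?_
  rw [integral_map hf.measurable.aemeasurable g.continuous.aestronglyMeasurable, h]

variable [CompactSpace X]

lemma continuous_integral_of_continuous {g : X → ℝ} (hg : Continuous g) :
    Continuous fun μ : ProbabilityMeasure X => ∫ x, g x ∂(μ : Measure X) :=
  ProbabilityMeasure.continuous_integral_continuousMap (ContinuousMap.mk g hg)

lemma continuous_codeInfo (hψ : ∀ a, Continuous (ψ a)) (hf : Continuous f) (n : ℕ) :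
    Continuous fun μ : ProbabilityMeasure X => codeInfo f ψ μ n := by
  refine Continuous.sub ?_ ?_
  · refine continuous_finsetSum _ fun c _ => continuous_negMulLog.comp ?_
    refine continuous_integral_of_continuous ?_
    exact continuous_finsetProd _ fun i _ => (hψ _).comp (hf.iterate _)
  · refine continuous_finsetSum _ fun i _ => continuous_integral_of_continuous ?_
    exact continuous_finsetSum _ fun a _ => continuous_negMulLog.comp ((hψ a).comp (hf.iterate i))

end EmpiricalMeasures

section InvariantMeasures

open Real

variable {X ι : Type*} [MetricSpace X]

/-- A continuous partition of unity subordinate to small balls. -/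
lemma exists_continuous_observable [CompactSpace X] [MeasurableSpace X] [BorelSpace X]
    {ε : ℝ} (hε : 0 < ε) :
    ∃ (t : Finset X) (ψ : t → X → ℝ), IsObservable ψ ∧ (∀ a, Continuous (ψ a)) ∧
      ∀ a x y, ψ a x ≠ 0 → ψ a y ≠ 0 → dist x y ≤ ε := by
  obtain ⟨t, ht⟩ := isCompact_univ.elim_finite_subcover (fun x : X => Metric.ball x (ε / 2))
    (fun x => Metric.isOpen_ball) fun x _ => mem_iUnion.2 ⟨x, by simpa using hε⟩
  set φ : t → X → ℝ := fun a x => max 0 (ε / 2 - dist x a) with hφ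
  have hφ0 : ∀ a x, 0 ≤ φ a x := fun a x => le_max_left _ _
  have hφc : ∀ a, Continuous (φ a) := fun a => by fun_prop
  have hpos : ∀ x, 0 < ∑ a, φ a x := by
    intro x
    obtain ⟨a, ha, hx⟩ : ∃ a ∈ t, dist x a < ε / 2 := by simpa using ht (mem_univ x)
    refine Finset.sum_pos' (fun a _ => hφ0 a x) ⟨⟨a, ha⟩, Finset.mem_univ _, ?_⟩
    exact lt_max_of_lt_right (sub_pos.2 hx)
  have hψc : ∀ a, Continuous fun x => φ a x / ∑ b, φ b x := fun a =>
    (hφc a).div (continuous_finsetSum _ fun b _ => hφc b) fun x => (hpos x).ne'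
  have hsupp : ∀ a x, φ a x / ∑ b, φ b x ≠ 0 → dist x a < ε / 2 := by
    intro a x h
    by_contra! hx
    refine h ?_
    rw [show φ a x = 0 from max_eq_left (by linarith), zero_div]
  refine ⟨t, fun a x => φ a x / ∑ b, φ b x, ⟨fun a => (hψc a).measurable,
    fun a x => div_nonneg (hφ0 a x) (hpos x).le, fun x => ?_⟩, hψc, fun a x y hx hy => ?_⟩
  · rw [← Finset.sum_div, div_self (hpos x).ne']
  · linarith [dist_triangle_right x y a, hsupp a x hx, hsupp a y hy]

variable [MeasurableSpace X] [BorelSpace X] [Fintype ι]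

/-- The invariant probability measures whose information rate is at least `s`. -/
def infoSuperlevel (f : X → X) (ψ : ι → X → ℝ) (s : ℝ) : Set (ProbabilityMeasure X) :=
  {μ | (∀ g : C(X, ℝ), ∫ x, g (f x) ∂(μ : Measure X) = ∫ x, g x ∂(μ : Measure X)) ∧
    ∀ m : ℕ, m * s ≤ codeInfo f ψ μ m}

variable {f : X → X} {ψ : ι → X → ℝ}

lemma measurePreserving_of_mem_infoSuperlevel (hf : Continuous f) {s : ℝ}
    {μ : ProbabilityMeasure X} (hμ : μ ∈ infoSuperlevel f ψ s) :
    MeasurePreserving f (μ : Measure X) μ :=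
  measurePreserving_of_forall_integral_eq hf _ fun g => hμ.1 g.toContinuousMap

lemma mem_infoSuperlevel (hf : Continuous f) {s : ℝ} {μ : ProbabilityMeasure X}
    (hμ : MeasurePreserving f (μ : Measure X) μ) (h : ∀ m : ℕ, m * s ≤ codeInfo f ψ μ m) :
    μ ∈ infoSuperlevel f ψ s := by
  refine ⟨fun g => ?_, h⟩
  conv_rhs => rw [← hμ.map_eq]
  rw [integral_map hf.measurable.aemeasurable g.continuous.aestronglyMeasurable]

variable [CompactSpace X]

lemma isClosed_infoSuperlevel_prod (hf : Continuous f) (hψ : ∀ a, Continuous (ψ a)) :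
    IsClosed {p : ℝ × ProbabilityMeasure X | p.2 ∈ infoSuperlevel f ψ p.1} := by
  have h : {p : ℝ × ProbabilityMeasure X | p.2 ∈ infoSuperlevel f ψ p.1} =
      (⋂ g : C(X, ℝ), {p : ℝ × ProbabilityMeasure X |
        ∫ x, g (f x) ∂(p.2 : Measure X) = ∫ x, g x ∂(p.2 : Measure X)}) ∩
      ⋂ m : ℕ, {p : ℝ × ProbabilityMeasure X | m * p.1 ≤ codeInfo f ψ p.2 m} := by
    ext p
    simp [infoSuperlevel]
  rw [h]
  refine IsClosed.inter ?_ ?_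
  · refine isClosed_iInter fun g => isClosed_eq ?_ ?_
    · exact (continuous_integral_of_continuous (g.continuous.comp hf)).comp continuous_snd
    · exact (continuous_integral_of_continuous g.continuous).comp continuous_snd
  · refine isClosed_iInter fun m => isClosed_le (by fun_prop) ?_
    exact (continuous_codeInfo hψ hf m).comp continuous_snd

lemma isCompact_infoSuperlevel (hf : Continuous f) (hψ : ∀ a, Continuous (ψ a)) (s : ℝ) :
    IsCompact (infoSuperlevel f ψ s) :=
  ((isClosed_infoSuperlevel_prod hf hψ).preimage (Continuous.prodMk_right s)).isCompact

/-- Separated sets of exponentially large cardinality produce an invariant measure. -/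
lemma infoSuperlevel_nonempty (hf : Continuous f) (hψ : IsObservable ψ)
    (hψc : ∀ a, Continuous (ψ a)) {ε : ℝ}
    (hsupp : ∀ a x y, ψ a x ≠ 0 → ψ a y ≠ 0 → dist x y ≤ ε) {s : ℝ}
    (hs : ∃ᶠ n : ℕ in atTop, ∃ S : Finset X, IsDynSep f univ n ε ↑S ∧ S.Nonempty ∧
      s ≤ log S.card / n) : (infoSuperlevel f ψ s).Nonempty := by
  set C : ℕ → ℝ := fun m => ∑ j ∈ Finset.range m, (Fintype.card (Fin j → ι) : ℝ) with hC
  set G : ℕ → ProbabilityMeasure X → Prop := fun n μ =>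
    (∀ m : ℕ, m * s ≤ codeInfo f ψ μ m + C m / n) ∧
      ∀ g : C(X, ℝ), |∫ x, g (f x) ∂(μ : Measure X) - ∫ x, g x ∂(μ : Measure X)| ≤ 2 * ‖g‖ / n
    with hG
  have hfreq : ∃ᶠ n : ℕ in atTop, ∃ μ, G n μ := by
    refine (hs.and_eventually (eventually_gt_atTop 0)).mono ?_
    rintro n ⟨⟨S, hS, hne, hle⟩, hn⟩
    obtain ⟨μ, h1, h2⟩ := exists_probabilityMeasure_of_isDynSep hψ hf hsupp hn hS hne
    refine ⟨μ, fun m => le_trans ?_ (h1 m), h2⟩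
    rw [mul_div_assoc]
    gcongr
  obtain ⟨n₀, μ₀, -⟩ := hfreq.exists
  have : Nonempty (ProbabilityMeasure X) := ⟨μ₀⟩
  have hch : ∀ n, ∃ μ, (∃ μ', G n μ') → G n μ := fun n => by
    by_cases h : ∃ μ', G n μ'
    · exact ⟨h.choose, fun _ => h.choose_spec⟩
    · exact ⟨μ₀, fun h' => absurd h' h⟩
  choose u hu using hch
  have : (atTop ⊓ 𝓟 {n : ℕ | ∃ μ, G n μ}).NeBot := frequently_mem_iff_neBot.1 hfreq
  obtain ⟨μ, hμ⟩ := exists_clusterPt_of_compactSpace (map u (atTop ⊓ 𝓟 {n : ℕ | ∃ μ, G n μ}))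
  obtain ⟨U, hU, hlim⟩ := mapClusterPt_iff_ultrafilter.1 hμ
  have hUtop : (U : Filter ℕ) ≤ atTop := hU.trans inf_le_left
  have hUG : ∀ᶠ n in (U : Filter ℕ), G n (u n) :=
    Eventually.mono (hU.trans inf_le_right (mem_principal_self _)) hu
  have hdiv : ∀ c : ℝ, Tendsto (fun n : ℕ => c / n) U (𝓝 0) := fun c =>
    (tendsto_const_div_atTop_nhds_zero_nat c).mono_left hUtop
  refine ⟨μ, fun g => ?_, fun m => ?_⟩
  · have h1 := ((continuous_integral_of_continuous (g.continuous.comp hf)).tendsto μ).comp hlim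
    have h2 := ((continuous_integral_of_continuous g.continuous).tendsto μ).comp hlim
    have h3 := le_of_tendsto_of_tendsto (h1.sub h2).abs (hdiv (2 * ‖g‖))
      (hUG.mono fun n hn => hn.2 g)
    exact sub_eq_zero.1 (abs_nonpos_iff.1 h3)
  · have h1 := ((continuous_codeInfo hψc hf m).tendsto μ).comp hlim
    simpa using ge_of_tendsto (h1.add (hdiv (C m))) (hUG.mono fun n hn => hn.1 m)

end InvariantMeasures

section ErgodicMaximizer

open Real

/-- There is a continuous strictly convex function on the space of probability measures. -/
lemma exists_continuous_strictConvex (X : Type*) [MetricSpace X] [CompactSpace X]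
    [MeasurableSpace X] [BorelSpace X] :
    ∃ Q : ProbabilityMeasure X → ℝ, Continuous Q ∧
      ∀ (w : Bool → ℝ) (ν : Bool → ProbabilityMeasure X) (μ : ProbabilityMeasure X),
        (∀ i, 0 < w i) → ∑ i, w i = 1 → (μ : Measure X) = mixture w (fun i => (ν i : Measure X)) →
        Q (ν true) ≤ Q μ → Q (ν false) ≤ Q μ → ν true = ν false := by
  set e : ℕ → C(X, ℝ) := fun i => (1 + ‖TopologicalSpace.denseSeq C(X, ℝ) i‖)⁻¹ •
    TopologicalSpace.denseSeq C(X, ℝ) i with he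
  have he1 : ∀ i, ‖e i‖ ≤ 1 := fun i => by
    have : 0 ≤ ‖TopologicalSpace.denseSeq C(X, ℝ) i‖ := norm_nonneg _
    rw [he, norm_smul, norm_inv, Real.norm_of_nonneg (by positivity),
      inv_mul_le_iff₀ (by positivity)]
    linarith
  have hinteg : ∀ (h : C(X, ℝ)) (ρ : ProbabilityMeasure X), Integrable h (ρ : Measure X) :=
    fun h ρ => h.continuous.integrable_of_hasCompactSupport (HasCompactSupport.of_compactSpace _)
  have hI : ∀ i (ρ : ProbabilityMeasure X), ‖(1 / 2 : ℝ) ^ i * (∫ x, e i x ∂(ρ : Measure X)) ^ 2‖ ≤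
      (1 / 2) ^ i := by
    intro i ρ
    have h1 : |∫ x, e i x ∂(ρ : Measure X)| ≤ 1 := by
      have := norm_integral_le_of_norm_le_const (μ := (ρ : Measure X)) (f := fun x => e i x)
        (C := 1) (Eventually.of_forall fun x => ((e i).norm_coe_le_norm x).trans (he1 i))
      simpa using this
    rw [Real.norm_of_nonneg (by positivity)]
    exact mul_le_of_le_one_right (by positivity) ((sq_le_one_iff_abs_le_one _).2 h1)
  have hsum : ∀ ρ : ProbabilityMeasure X, Summable fun i =>
      (1 / 2 : ℝ) ^ i * (∫ x, e i x ∂(ρ : Measure X)) ^ 2 := fun ρ =>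
    Summable.of_norm_bounded summable_geometric_two fun i => hI i ρ
  refine ⟨fun ρ => ∑' i, (1 / 2 : ℝ) ^ i * (∫ x, e i x ∂(ρ : Measure X)) ^ 2,
    continuous_tsum (fun i => continuous_const.mul
      ((continuous_integral_of_continuous (e i).continuous).pow 2)) summable_geometric_two hI, ?_⟩
  intro w ν μ hw hw1 hμ h1 h2
  have hμe : ∀ i, ∫ x, e i x ∂(μ : Measure X) =
      w true * ∫ x, e i x ∂(ν true : Measure X) + w false * ∫ x, e i x ∂(ν false : Measure X) := by
    intro i
    rw [hμ, integral_mixture (fun i => (hw i).le) fun j => hinteg (e i) (ν j), Fintype.sum_bool]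
  rw [Fintype.sum_bool] at hw1
  have hs := (((hsum (ν true)).hasSum.mul_left (w true)).add
    ((hsum (ν false)).hasSum.mul_left (w false))).sub (hsum μ).hasSum
  have hterm : ∀ i, w true * ((1 / 2 : ℝ) ^ i * (∫ x, e i x ∂(ν true : Measure X)) ^ 2) +
      w false * ((1 / 2 : ℝ) ^ i * (∫ x, e i x ∂(ν false : Measure X)) ^ 2) -
      (1 / 2 : ℝ) ^ i * (∫ x, e i x ∂(μ : Measure X)) ^ 2 =
      (1 / 2 : ℝ) ^ i * (w true * w false) *
        (∫ x, e i x ∂(ν true : Measure X) - ∫ x, e i x ∂(ν false : Measure X)) ^ 2 := by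
    intro i
    rw [hμe, show w false = 1 - w true by linarith]
    ring
  simp only [hterm] at hs
  have hnn : ∀ i, 0 ≤ (1 / 2 : ℝ) ^ i * (w true * w false) *
        (∫ x, e i x ∂(ν true : Measure X) - ∫ x, e i x ∂(ν false : Measure X)) ^ 2 := fun i => by
    have := hw true
    have := hw false
    positivity
  have hzero := hs.nonneg hnn
  have hval : w true * ∑' i, (1 / 2 : ℝ) ^ i * (∫ x, e i x ∂(ν true : Measure X)) ^ 2 +
      w false * ∑' i, (1 / 2 : ℝ) ^ i * (∫ x, e i x ∂(ν false : Measure X)) ^ 2 -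
      ∑' i, (1 / 2 : ℝ) ^ i * (∫ x, e i x ∂(μ : Measure X)) ^ 2 = 0 := by
    refine le_antisymm ?_ hzero
    have h3 := mul_le_mul_of_nonneg_left h1 (hw true).le
    have h4 := mul_le_mul_of_nonneg_left h2 (hw false).le
    have h5 := congrArg (· * ∑' i, (1 / 2 : ℝ) ^ i * (∫ x, e i x ∂(μ : Measure X)) ^ 2) hw1
    simp only [add_mul, one_mul] at h5
    linarith
  rw [hval, hasSum_zero_iff_of_nonneg hnn] at hs
  have heq : ∀ i, ∫ x, e i x ∂(ν true : Measure X) = ∫ x, e i x ∂(ν false : Measure X) := by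
    intro i
    have hi := congrFun hs i
    have hne : (1 / 2 : ℝ) ^ i * (w true * w false) ≠ 0 :=
      (mul_pos (by positivity) (mul_pos (hw true) (hw false))).ne'
    simp only [Pi.zero_apply, mul_eq_zero, hne, false_or, pow_eq_zero_iff two_ne_zero] at hi
    exact sub_eq_zero.1 hi
  have hdense : ∀ g : C(X, ℝ),
      ∫ x, g x ∂(ν true : Measure X) = ∫ x, g x ∂(ν false : Measure X) := by
    have hc : ∀ ρ : ProbabilityMeasure X,
        Continuous fun g : C(X, ℝ) => ∫ x, g x ∂(ρ : Measure X) := by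
      intro ρ
      refine LipschitzWith.continuous (K := 1) (LipschitzWith.of_dist_le_mul fun g h => ?_)
      rw [Real.dist_eq, ← integral_sub (hinteg g ρ) (hinteg h ρ), NNReal.coe_one, one_mul]
      have := norm_integral_le_of_norm_le_const (μ := (ρ : Measure X)) (f := fun x => g x - h x)
        (C := dist g h) (Eventually.of_forall fun x => by
          rw [← dist_eq_norm]
          exact ContinuousMap.dist_apply_le_dist x)
      simpa using this
    refine congrFun ((TopologicalSpace.denseRange_denseSeq C(X, ℝ)).equalizer (hc _) (hc _)
      (funext fun i => ?_))
    have hi := heq i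
    have hpos : (1 + ‖TopologicalSpace.denseSeq C(X, ℝ) i‖)⁻¹ ≠ 0 := by positivity
    simpa [he, integral_const_mul, hpos] using hi
  have hmeas : (ν true : Measure X) = ν false :=
    ext_of_forall_integral_eq_of_IsFiniteMeasure fun g => hdense g.toContinuousMap
  exact Subtype.ext hmeas

/-- The decomposition of a measure along a set and its complement. -/
lemma eq_mixture_cond {X : Type*} [MeasurableSpace X] (μ : Measure X) [IsProbabilityMeasure μ]
    {S : Set X} (hS : MeasurableSet S) (h0 : μ S ≠ 0) (h1 : μ Sᶜ ≠ 0) :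
    μ = mixture (fun b => μ.real (cond b S Sᶜ))
      fun b => ProbabilityTheory.cond μ (cond b S Sᶜ) := by
  have h : ∀ T, μ T ≠ 0 → ENNReal.ofReal (μ.real T) • ProbabilityTheory.cond μ T =
      μ.restrict T := fun T hT => by
    rw [ofReal_measureReal, ProbabilityTheory.cond, smul_smul,
      ENNReal.mul_inv_cancel hT (measure_ne_top _ _), one_smul]
  rw [mixture, Fintype.sum_bool]
  simp only [cond_true, cond_false]
  rw [h _ h0, h _ h1, Measure.restrict_add_restrict_compl hS]

lemma measurePreserving_cond {X : Type*} [MeasurableSpace X] {f : X → X} {μ : Measure X}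
    (hμ : MeasurePreserving f μ μ) {S : Set X} (hS : MeasurableSet S) (hfS : f ⁻¹' S = S) :
    MeasurePreserving f (ProbabilityTheory.cond μ S) (ProbabilityTheory.cond μ S) := by
  have h := hμ.restrict_preimage hS
  rw [hfS] at h
  exact h.smul_measure _

variable {X ι : Type*} [MetricSpace X] [MeasurableSpace X] [Fintype ι] {f : X → X} {ψ : ι → X → ℝ}

lemma le_of_infoSuperlevel_nonempty (hψ : IsObservable ψ) {s : ℝ}
    (hs : (infoSuperlevel f ψ s).Nonempty) : s ≤ Fintype.card (Fin 1 → ι) := by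
  obtain ⟨μ, hμ⟩ := hs
  simpa using (hμ.2 1).trans (codeInfo_le_card hψ _ 1)

variable [BorelSpace X]

/-- The information rate of an invariant measure. -/
lemma exists_tendsto_codeInfo_div (hf : Continuous f) (hψ : IsObservable ψ)
    {μ : ProbabilityMeasure X} (hμ : MeasurePreserving f (μ : Measure X) μ) :
    ∃ r, μ ∈ infoSuperlevel f ψ r ∧
      Tendsto (fun n : ℕ => codeInfo f ψ μ n / n) atTop (𝓝 r) := by
  have hsub : Subadditive fun n => codeInfo f ψ μ n := fun p q => by
    simpa [map_iterate_eq hμ p] using codeInfo_add_le (μ := (μ : Measure X)) hψ hf.measurable p q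
  have hbdd : BddBelow (range fun n : ℕ => codeInfo f ψ μ n / n) := by
    refine ⟨-Fintype.card ι, ?_⟩
    rintro _ ⟨n, rfl⟩
    rcases n.eq_zero_or_pos with rfl | hn
    · simp
    have := hψ.neg_mul_card_le_codeInfo (μ := (μ : Measure X)) hf.measurable n
    change -(Fintype.card ι : ℝ) ≤ codeInfo f ψ μ n / n
    rw [le_div_iff₀ (by exact_mod_cast hn)]
    linarith
  refine ⟨hsub.lim, mem_infoSuperlevel hf hμ fun n => ?_, hsub.tendsto_lim hbdd⟩
  rcases n.eq_zero_or_pos with rfl | hn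
  · simp [codeInfo, codeEntropy_zero]
  · have := hsub.lim_le_div hbdd hn.ne'
    rwa [le_div_iff₀' (by exact_mod_cast hn)] at this

/-- A maximal information rate passes to the components of a mixture. -/
lemma mem_infoSuperlevel_of_mixture (hf : Continuous f) (hψ : IsObservable ψ) {h : ℝ}
    (hmax : ∀ t, (infoSuperlevel f ψ t).Nonempty → t ≤ h) {μ : ProbabilityMeasure X}
    (hμ : μ ∈ infoSuperlevel f ψ h) {w : Bool → ℝ} {ν : Bool → ProbabilityMeasure X}
    (hw : ∀ i, 0 < w i) (hw1 : ∑ i, w i = 1)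
    (hmix : (μ : Measure X) = mixture w fun i => (ν i : Measure X))
    (hν : ∀ i, MeasurePreserving f (ν i : Measure X) (ν i)) (i : Bool) :
    ν i ∈ infoSuperlevel f ψ h := by
  choose r hr hlim using fun i => exists_tendsto_codeInfo_div hf hψ (hν i)
  have hrh : ∀ i, r i ≤ h := fun i => hmax _ ⟨_, hr i⟩
  have hle : h ≤ ∑ i, w i * r i := by
    have h1 : Tendsto (fun n : ℕ => ∑ i, w i * (codeInfo f ψ (ν i) n / n) +
        (∑ i, negMulLog (w i)) / n) atTop (𝓝 (∑ i, w i * r i + 0)) :=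
      (tendsto_finsetSum _ fun i _ => (hlim i).const_mul (w i)).add
        (tendsto_const_div_atTop_nhds_zero_nat _)
    rw [add_zero] at h1
    refine ge_of_tendsto h1 ((eventually_gt_atTop 0).mono fun n hn => ?_)
    have hn' : (0 : ℝ) < n := by exact_mod_cast hn
    have h2 := (hμ.2 n).trans (hmix ▸ codeInfo_mixture_le hψ hf.measurable (fun i => (hw i).le) n)
    simp only [← mul_div_assoc]
    rw [← Finset.sum_div, ← add_div, le_div_iff₀ hn']
    linarith
  rw [Fintype.sum_bool] at hle hw1
  have hri : r i = h := by
    refine le_antisymm (hrh i) ?_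
    have h1 := mul_le_mul_of_nonneg_left (hrh true) (hw true).le
    have h2 := mul_le_mul_of_nonneg_left (hrh false) (hw false).le
    have h3 := congrArg (· * h) hw1
    simp only [add_mul, one_mul] at h3
    cases i
    · exact le_of_mul_le_mul_left (by linarith) (hw false)
    · exact le_of_mul_le_mul_left (by linarith) (hw true)
  exact hri ▸ hr i

variable [CompactSpace X]

/-- The largest information rate is attained. -/
lemma exists_max_infoSuperlevel (hf : Continuous f) (hψ : IsObservable ψ)
    (hψc : ∀ a, Continuous (ψ a)) {s : ℝ} (hs : (infoSuperlevel f ψ s).Nonempty) :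
    ∃ h, s ≤ h ∧ (infoSuperlevel f ψ h).Nonempty ∧
      ∀ t, (infoSuperlevel f ψ t).Nonempty → t ≤ h := by
  have hK : IsCompact ({p : ℝ × ProbabilityMeasure X | p.2 ∈ infoSuperlevel f ψ p.1} ∩
      Icc s (Fintype.card (Fin 1 → ι)) ×ˢ univ) :=
    (isCompact_Icc.prod isCompact_univ).inter_left (isClosed_infoSuperlevel_prod hf hψc)
  obtain ⟨μ, hμ⟩ := hs
  obtain ⟨⟨h, μ'⟩, ⟨hmem, hIcc, -⟩, hmax⟩ := hK.exists_isMaxOn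
    ⟨(s, μ), hμ, ⟨le_rfl, le_of_infoSuperlevel_nonempty hψ ⟨μ, hμ⟩⟩, mem_univ _⟩
    continuous_fst.continuousOn
  refine ⟨h, hIcc.1, ⟨μ', hmem⟩, fun t ht => ?_⟩
  rcases le_total t s with hts | hst
  · exact hts.trans hIcc.1
  · obtain ⟨ρ, hρ⟩ := ht
    exact hmax (a := (t, ρ)) ⟨hρ, ⟨hst, le_of_infoSuperlevel_nonempty hψ ⟨ρ, hρ⟩⟩, mem_univ _⟩

/-- The largest information rate is attained by an ergodic measure. -/
lemma exists_ergodic_mem_infoSuperlevel (hf : Continuous f) (hψ : IsObservable ψ)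
    (hψc : ∀ a, Continuous (ψ a)) {s : ℝ} (hs : (infoSuperlevel f ψ s).Nonempty) :
    ∃ μ : Measure X, IsProbabilityMeasure μ ∧ Ergodic f μ ∧
      ∀ m : ℕ, m * s ≤ codeInfo f ψ μ m := by
  obtain ⟨h, hsh, hne, hmax⟩ := exists_max_infoSuperlevel hf hψ hψc hs
  obtain ⟨Q, hQc, hQ⟩ := exists_continuous_strictConvex X
  obtain ⟨μ, hμ, hμQ⟩ := (isCompact_infoSuperlevel hf hψc h).exists_isMaxOn hne hQc.continuousOn
  have hpres := measurePreserving_of_mem_infoSuperlevel hf hμ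
  refine ⟨μ, inferInstance, ⟨hpres, ⟨fun S hS hfS => ?_⟩⟩, fun m => le_trans ?_ (hμ.2 m)⟩
  · by_contra hconst
    rw [eventuallyConst_set'] at hconst
    push Not at hconst
    have h0 : (μ : Measure X) S ≠ 0 := fun h0 => hconst.1 (ae_eq_empty.2 h0)
    have h1 : (μ : Measure X) Sᶜ ≠ 0 := fun h1 => hconst.2 (ae_eq_univ.2 h1)
    have hb : ∀ b : Bool, (μ : Measure X) (cond b S Sᶜ) ≠ 0 := by
      rintro (_ | _)
      exacts [h1, h0]
    set ν : Bool → ProbabilityMeasure X := fun b =>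
      ⟨ProbabilityTheory.cond μ (cond b S Sᶜ), ProbabilityTheory.cond_isProbabilityMeasure (hb b)⟩
      with hν
    have hmix : (μ : Measure X) = mixture (fun b => (μ : Measure X).real (cond b S Sᶜ))
        fun b => (ν b : Measure X) := eq_mixture_cond μ hS h0 h1
    have hw : ∀ b : Bool, 0 < (μ : Measure X).real (cond b S Sᶜ) := fun b =>
      ENNReal.toReal_pos (hb b) (measure_ne_top _ _)
    have hw1 : ∑ b, (μ : Measure X).real (cond b S Sᶜ) = 1 := by
      rw [Fintype.sum_bool]
      simp only [cond_true, cond_false]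
      rw [probReal_compl_eq_one_sub hS]
      ring
    have hνp : ∀ b, MeasurePreserving f (ν b : Measure X) (ν b) := by
      rintro (_ | _)
      · exact measurePreserving_cond hpres hS.compl (by simp [hfS])
      · exact measurePreserving_cond hpres hS hfS
    have hmem := mem_infoSuperlevel_of_mixture hf hψ hmax hμ hw hw1 hmix hνp
    have heq := hQ _ ν μ hw hw1 hmix (hμQ (hmem true)) (hμQ (hmem false))
    have h2 : ProbabilityTheory.cond (μ : Measure X) S S =
        ProbabilityTheory.cond (μ : Measure X) Sᶜ S :=
      congrArg (fun ρ : ProbabilityMeasure X => (ρ : Measure X) S) heq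
    rw [ProbabilityTheory.cond_apply hS, ProbabilityTheory.cond_apply hS.compl, inter_self,
      compl_inter_self, measure_empty, mul_zero,
      ENNReal.inv_mul_cancel h0 (measure_ne_top _ _)] at h2
    exact one_ne_zero h2
  · gcongr

end ErgodicMaximizer

section VariationalPrinciple

open Real

variable {X : Type*} [MetricSpace X] [CompactSpace X] [MeasurableSpace X] [BorelSpace X]

/-- The other half of the variational principle: topological entropy is approximated by the metric
entropy of ergodic measures. -/
theorem exists_ergodic_le_ksEnt [Nonempty X] {f : X → X} (hf : Continuous f) {s : ℝ}
    (hs : (s : EReal) < topEnt f univ) :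
    ∃ μ : Measure X, IsProbabilityMeasure μ ∧ Ergodic f μ ∧ (s : EReal) ≤ ksEnt f μ := by
  obtain ⟨x₀⟩ := ‹Nonempty X›
  simp only [topEnt, compactEnt, lt_iSup_iff] at hs
  obtain ⟨E, -, -, ε, hε, hs⟩ := hs
  have hfreq : ∃ᶠ n : ℕ in atTop, ∃ S : Finset X, IsDynSep f univ n ε ↑S ∧ S.Nonempty ∧
      s ≤ log S.card / n := by
    refine (frequently_lt_of_lt_limsup (by isBoundedDefault) hs).mono fun n hn => ?_
    have hn : s < log (sepCount f E n ε) / n := by exact_mod_cast hn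
    have hne : {k | ∃ S : Finset X, IsDynSep f E n ε ↑S ∧ S.card = k}.Nonempty :=
      ⟨0, ∅, by simp [IsDynSep], rfl⟩
    obtain ⟨S, hS, hcard⟩ := Nat.sSup_mem hne (bddAbove_card_isDynSep hf E n hε)
    rcases S.eq_empty_or_nonempty with rfl | hSne
    · refine ⟨{x₀}, by simp [IsDynSep], by simp, ?_⟩
      rw [sepCount, ← hcard] at hn
      simpa using hn.le
    · exact ⟨S, ⟨subset_univ _, hS.2⟩, hSne, hcard ▸ hn.le⟩
  obtain ⟨t, ψ, hψ, hψc, hsupp⟩ := exists_continuous_observable (X := X) hε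
  obtain ⟨μ, hμ, herg, hle⟩ := exists_ergodic_mem_infoSuperlevel hf hψ hψc
    (infoSuperlevel_nonempty hf hψ hψc hsupp hfreq)
  exact ⟨μ, hμ, herg, le_ksEnt_of_le_codeInfo herg.toMeasurePreserving hψ hle⟩

end VariationalPrinciple

/-- **Proposition 2.13 (1).** Let `f` be a homeomorphism of a compact metric space and
`A : X → GL(m,ℝ)` a continuous matrix function. If two ergodic invariant measures have
different maximal Lyapunov exponents w.r.t. `A`, then
`h_top(f) = sup {max{h_μ(f), h_ν(f)} : μ, ν ergodic, χ_max(A,μ) > χ_max(A,ν)}`. -/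
theorem htop_eq_sup_max_entropies_of_different_mle
    {X : Type*} [MetricSpace X] [CompactSpace X] [MeasurableSpace X] [BorelSpace X] {m : ℕ}
    (f : X ≃ₜ X) (A : X → (Em m ≃L[ℝ] Em m))
    (hA : Continuous fun x => ((A x : Em m →L[ℝ] Em m)))
    (hdiff : ∃ μ ν : Measure X, IsProbabilityMeasure μ ∧ IsProbabilityMeasure ν ∧
      Ergodic (⇑f) μ ∧ Ergodic (⇑f) ν ∧ mle (⇑f) A μ ≠ mle (⇑f) A ν) :
    topEnt (⇑f) univ =
      sSup {h : EReal | ∃ μ ν : Measure X, IsProbabilityMeasure μ ∧ IsProbabilityMeasure ν ∧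
        Ergodic (⇑f) μ ∧ Ergodic (⇑f) ν ∧ mle (⇑f) A ν < mle (⇑f) A μ ∧
        h = max (ksEnt (⇑f) μ) (ksEnt (⇑f) ν)} := by
  obtain ⟨μ₁, μ₂, hp₁, hp₂, he₁, he₂, hne⟩ := hdiff
  have : Nonempty X := nonempty_of_isProbabilityMeasure μ₁
  apply le_antisymm
  · refine EReal.ge_of_forall_gt_iff_ge.1 fun s hs => ?_
    obtain ⟨μ, hμ, herg, hle⟩ := exists_ergodic_le_ksEnt f.continuous hs
    obtain ⟨ν, hν, hνe, hνne⟩ : ∃ ν : Measure X, IsProbabilityMeasure ν ∧ Ergodic f ν ∧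
        mle f A ν ≠ mle f A μ := by
      by_cases h : mle f A μ₁ = mle f A μ
      · exact ⟨μ₂, hp₂, he₂, fun h' => hne (h.trans h'.symm)⟩
      · exact ⟨μ₁, hp₁, he₁, h⟩
    rcases hνne.lt_or_gt with hlt | hgt
    · exact hle.trans ((le_max_left _ _).trans (le_sSup ⟨μ, ν, hμ, hν, herg, hνe, hlt, rfl⟩))
    · exact hle.trans ((le_max_right _ _).trans (le_sSup ⟨ν, μ, hν, hμ, hνe, herg, hgt, rfl⟩))
  · refine sSup_le ?_
    rintro _ ⟨μ, ν, hμ, hν, hμe, hνe, -, rfl⟩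
    exact max_le (ksEnt_le_topEnt f.continuous hμe.toMeasurePreserving)
      (ksEnt_le_topEnt f.continuous hνe.toMeasurePreserving)
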